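/- There exist constants ε ∈ (0,1), γ ∈ (0,1), c > 0 and n_0 such that for all n ≥ n_0 and all k < log₂ n the following holds. Let M be a k-pass streaming algorithm with s bits of memory on streams in {-1,1}^n, with a real-valued output that is a (possibly randomized) function of the final memory state. Suppose that for every input x ∈ {-1,1}^n all of whose prefix sums Σ_{j=1}^m x_j (m = 1,…,n) are nonnegative (a strict turnstile stream), with probability at least 1-γ over the algorithm's private randomness the output C' satisfies (1-ε)·C ≤ C' ≤ (1+ε)·C, where C = Σ_{j=1}^n x_j. Then s ≥ c·(log₂ n)/k. -/

import Mathlib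

open scoped Classical
open Finset

noncomputable section

namespace MultiPassIC

/-- Probability of an event under a probability mass function `p` on a finite sample space. -/
def pr {Ω : Type} [Fintype Ω] (p : Ω → ℝ) (E : Ω → Prop) : ℝ :=
  ∑ ω, if E ω then p ω else 0

/-- `p` is a probability mass function on the finite type `Ω`. -/
structure IsPMF {Ω : Type} [Fintype Ω] (p : Ω → ℝ) : Prop where
  nonneg : ∀ ω, 0 ≤ p ω
  sum_one : ∑ ω, p ω = 1

/-- A `k`-pass streaming algorithm on (deterministic) input streams over the alphabet `𝒳`,
with internal randomness living on the finite sample space `Ω` with pmf `p`: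
`S` is the finite set of memory states, `Rv` the value space of the per-step private
randomness, `init` the (random) initial memory state `M₀`, `R i j` the private randomness
used at step `j` of pass `i` (0-indexed), and `f i j` the corresponding transition
function.  The field `indep` states that the initial state and all the per-step random
seeds are mutually independent. -/
structure AlgD (Ω : Type) [Fintype Ω] (p : Ω → ℝ) (𝒳 : Type) (n k : ℕ) where
  S : Type
  fintS : Fintype S
  Rv : Type
  fintR : Fintype Rv
  init : Ω → S
  R : ℕ → ℕ → Ω → Rv
  f : ℕ → ℕ → 𝒳 → S → Rv → S
  indep : ∀ (m : S) (r : ℕ → ℕ → Rv),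
    pr p (fun ω => init ω = m ∧ ∀ i < k, ∀ j < n, R i j ω = r i j)
      = pr p (fun ω => init ω = m)
        * ∏ i ∈ Finset.range k, ∏ j ∈ Finset.range n, pr p (fun ω => R i j ω = r i j)

attribute [instance] AlgD.fintS AlgD.fintR

variable {Ω : Type} [Fintype Ω] {p : Ω → ℝ} {𝒳 : Type} {n k : ℕ}

/-- Running pass `i` (0-indexed) on the input stream `x` for `j` steps, starting from `ini`. -/
def AlgD.runPass (M : AlgD Ω p 𝒳 n k) (x : ℕ → 𝒳) (i : ℕ) (ini : Ω → M.S) : ℕ → Ω → M.S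
  | 0 => ini
  | j + 1 => fun ω =>
      if j < n ∧ i < k then
        M.f i j (x j) (M.runPass x i ini j ω) (M.R i j ω)
      else M.runPass x i ini j ω

/-- The memory state at the end of pass `i` on input stream `x`. -/
def AlgD.passEnd (M : AlgD Ω p 𝒳 n k) (x : ℕ → 𝒳) : ℕ → Ω → M.S
  | 0 => M.init
  | i + 1 => M.runPass x i (M.passEnd x i) n

/-- The final memory state `M_{(k,n)}` on input stream `x`. -/
def AlgD.final (M : AlgD Ω p 𝒳 n k) (x : ℕ → 𝒳) : Ω → M.S :=
  M.passEnd x k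

end MultiPassIC

namespace MultiPassIC

/-- The ±1 value of a boolean stream update (insertion/deletion). -/
def coin (b : Bool) : ℝ := if b then 1 else -1

/-- Assignments of a bit to every step and of a state to every time. -/
abbrev Hist (Z : Type) : Type := (ℕ → Bool) × (ℕ → Z)

/-- The expectation, given the history up to time `u`, over a fair bit at step `u` and the next
state drawn from `q`. -/
def stepExp {Z : Type} [Fintype Z] (q : Bool → Z → Z → ℝ) (u : ℕ) :
    (Hist Z → ℝ) →ₗ[ℝ] (Hist Z → ℝ) where
  toFun F h := ∑ b, ∑ z, 1 / 2 * q b (h.2 u) z *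
    F (Function.update h.1 u b, Function.update h.2 (u + 1) z)
  map_add' F G := by
    funext h
    simp only [Pi.add_apply, mul_add, Finset.sum_add_distrib]
  map_smul' c F := by
    funext h
    simp only [Pi.smul_apply, smul_eq_mul, RingHom.id_apply, Finset.mul_sum]
    refine Finset.sum_congr rfl fun b _ => Finset.sum_congr rfl fun z _ => by ring

/-- The expectation over the steps `u, …, u + r - 1`, given the history up to time `u`. -/
def pathExp {Z : Type} [Fintype Z] (q : ℕ → Bool → Z → Z → ℝ) :
    ℕ → ℕ → (Hist Z → ℝ) →ₗ[ℝ] (Hist Z → ℝ)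
  | _, 0 => LinearMap.id
  | u, r + 1 => (stepExp (q u) u).comp (pathExp q (u + 1) r)

/-- The expectation over fair bits at the steps `u, …, u + r - 1`. -/
def coinExp : ℕ → ℕ → ((ℕ → Bool) → ℝ) → (ℕ → Bool) → ℝ
  | _, 0, f, x => f x
  | u, r + 1, f, x => ∑ b, 1 / 2 * coinExp (u + 1) r f (Function.update x u b)

/-- The expectation of `G` at the state at time `u + r`, started from `z` at time `u`, on a fixed
input stream. -/
def stateExp {Z : Type} [Fintype Z] (q : ℕ → Bool → Z → Z → ℝ) (x : ℕ → Bool) :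
    ℕ → ℕ → (Z → ℝ) → Z → ℝ
  | _, 0, G, z => G z
  | u, r + 1, G, z => ∑ z', q u (x u) z z' * stateExp q x (u + 1) r G z'

/-- Two histories agree up to time `u`. -/
def Agree {Z : Type} (u : ℕ) (h h' : Hist Z) : Prop :=
  (∀ j < u, h.1 j = h'.1 j) ∧ ∀ j ≤ u, h.2 j = h'.2 j

theorem agree_refl {Z : Type} (u : ℕ) (h : Hist Z) : Agree u h h :=
  ⟨fun _ _ => rfl, fun _ _ => rfl⟩

theorem Agree.of_update {Z : Type} {u : ℕ} {h h' : Hist Z} {b : Bool} {z : Z}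
    (H : Agree (u + 1) h' (Function.update h.1 u b, Function.update h.2 (u + 1) z)) :
    Agree u h' h ∧ h'.1 u = b ∧ h'.2 (u + 1) = z := by
  refine ⟨⟨fun j hj => ?_, fun j hj => ?_⟩, ?_, ?_⟩
  · rw [H.1 j (by omega)]; exact Function.update_of_ne (by omega) _ _
  · rw [H.2 j (by omega)]; exact Function.update_of_ne (by omega) _ _
  · rw [H.1 u (by omega)]; exact Function.update_self _ _ _
  · rw [H.2 (u + 1) le_rfl]; exact Function.update_self _ _ _

/-- The sum of the updates in the steps `u, …, t - 1`. -/
def seg (u t : ℕ) (x : ℕ → Bool) : ℝ := ∑ j ∈ Finset.Ico u t, coin (x j)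

theorem seg_self (u : ℕ) (x : ℕ → Bool) : seg u u x = 0 := by simp [seg]

theorem seg_add {u s t : ℕ} (h : u ≤ s) (h' : s ≤ t) (x : ℕ → Bool) :
    seg u t x = seg u s x + seg s t x := by
  simp only [seg]; rw [Finset.sum_Ico_consecutive _ h h']

theorem seg_congr {u t : ℕ} {x x' : ℕ → Bool} (h : ∀ j, u ≤ j → j < t → x j = x' j) :
    seg u t x = seg u t x' := by
  refine Finset.sum_congr rfl fun j hj => ?_
  rw [Finset.mem_Ico] at hj
  rw [h j hj.1 hj.2]

theorem abs_seg_le (u t : ℕ) (x : ℕ → Bool) : |seg u t x| ≤ ((t - u : ℕ) : ℝ) := by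
  refine (Finset.abs_sum_le_sum_abs _ _).trans ?_
  calc ∑ j ∈ Finset.Ico u t, |coin (x j)| ≤ ∑ j ∈ Finset.Ico u t, (1 : ℝ) :=
        Finset.sum_le_sum fun j _ => by unfold coin; split_ifs <;> simp
    _ = _ := by simp

theorem coinExp_congr {r u : ℕ} {f f' : (ℕ → Bool) → ℝ} {x : ℕ → Bool}
    (H : ∀ x', (∀ j < u, x' j = x j) → f x' = f' x') : coinExp u r f x = coinExp u r f' x := by
  induction r generalizing u x with
  | zero => exact H x fun _ _ => rfl
  | succ r ih =>
    refine Finset.sum_congr rfl fun b _ => ?_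
    rw [ih fun x' hx' => H x' fun j hj => ?_]
    rw [hx' j (by omega), Function.update_of_ne (by omega)]

theorem coinExp_mono {r u : ℕ} {f f' : (ℕ → Bool) → ℝ} {x : ℕ → Bool}
    (H : ∀ x', f x' ≤ f' x') : coinExp u r f x ≤ coinExp u r f' x := by
  induction r generalizing u x with
  | zero => exact H x
  | succ r ih => exact Finset.sum_le_sum fun b _ => mul_le_mul_of_nonneg_left ih (by norm_num)

theorem coinExp_const (u r : ℕ) (c : ℝ) (x : ℕ → Bool) : coinExp u r (fun _ => c) x = c := by
  induction r generalizing u x with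
  | zero => rfl
  | succ r ih => simp only [coinExp, ih]; simp

theorem coinExp_add (u r : ℕ) (f g : (ℕ → Bool) → ℝ) (x : ℕ → Bool) :
    coinExp u r (fun x => f x + g x) x = coinExp u r f x + coinExp u r g x := by
  induction r generalizing u x with
  | zero => rfl
  | succ r ih => simp only [coinExp, ih, mul_add, Finset.sum_add_distrib]

theorem coinExp_mul_left (u r : ℕ) (c : ℝ) (f : (ℕ → Bool) → ℝ) (x : ℕ → Bool) :
    coinExp u r (fun x => c * f x) x = c * coinExp u r f x := by
  induction r generalizing u x with
  | zero => rfl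
  | succ r ih => simp only [coinExp, ih, Fintype.sum_bool]; ring

theorem coinExp_sum {ι : Type} (s : Finset ι) (u r : ℕ) (f : ι → (ℕ → Bool) → ℝ) (x : ℕ → Bool) :
    coinExp u r (fun x => ∑ i ∈ s, f i x) x = ∑ i ∈ s, coinExp u r (f i) x := by
  induction s using Finset.induction_on with
  | empty => simpa using coinExp_const u r 0 x
  | insert i s hi ih => simp only [Finset.sum_insert hi, coinExp_add, ih]

theorem coinExp_comp (u r r' : ℕ) (f : (ℕ → Bool) → ℝ) (x : ℕ → Bool) :
    coinExp u (r + r') f x = coinExp u r (coinExp (u + r) r' f) x := by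
  induction r generalizing u x with
  | zero => simp [coinExp]
  | succ r ih =>
    rw [show r + 1 + r' = (r + r') + 1 by ring]
    simp only [coinExp, ih]
    rw [show u + 1 + r = u + (r + 1) by ring]

/-- The expectation of `f` at the endpoint of a simple random walk of length `r` from `y`. -/
def walkExp : ℕ → (ℝ → ℝ) → ℝ → ℝ
  | 0, f, y => f y
  | r + 1, f, y => (walkExp r f (y + 1) + walkExp r f (y - 1)) / 2

theorem coinExp_seg (u r : ℕ) (f : ℝ → ℝ) (y : ℝ) (x : ℕ → Bool) :
    coinExp u r (fun x => f (y + seg u (u + r) x)) x = walkExp r f y := by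
  induction r generalizing u x y with
  | zero => simp [coinExp, seg, walkExp]
  | succ r ih =>
    have key : ∀ b, coinExp (u + 1) r (fun x => f (y + seg u (u + (r + 1)) x))
        (Function.update x u b) = walkExp r f (y + coin b) := by
      intro b
      rw [← ih (u + 1) (y + coin b) (Function.update x u b)]
      refine coinExp_congr fun x' hx' => ?_
      rw [seg_add (Nat.le_succ u) (by omega : u + 1 ≤ u + (r + 1)),
        show u + (r + 1) = u + 1 + r by omega]
      have : seg u (u + 1) x' = coin b := by
        simp [seg, hx' u (Nat.lt_succ_self u)]
      rw [Nat.succ_eq_add_one, this, ← add_assoc]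
    simp only [coinExp, key, Fintype.sum_bool, walkExp, coin]
    simp; ring_nf

theorem walkExp_sq (r : ℕ) (y : ℝ) : walkExp r (fun s => s ^ 2) y = y ^ 2 + r := by
  induction r generalizing y with
  | zero => simp [walkExp]
  | succ r ih => simp only [walkExp, ih]; push_cast; ring

theorem walkExp_four (r : ℕ) (y : ℝ) :
    walkExp r (fun s => s ^ 4) y = y ^ 4 + 6 * r * y ^ 2 + 3 * r ^ 2 - 2 * r := by
  induction r generalizing y with
  | zero => simp [walkExp]
  | succ r ih => simp only [walkExp, ih]; push_cast; ring

theorem walkExp_neg (r : ℕ) (f : ℝ → ℝ) (y : ℝ) :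
    walkExp r (fun s => f (-s)) y = walkExp r f (-y) := by
  induction r generalizing y with
  | zero => rfl
  | succ r ih => simp only [walkExp, ih]; ring_nf

theorem walkExp_mono {r : ℕ} {f g : ℝ → ℝ} (h : ∀ s, f s ≤ g s) (y : ℝ) :
    walkExp r f y ≤ walkExp r g y := by
  induction r generalizing y with
  | zero => exact h y
  | succ r ih => simp only [walkExp]; linarith [ih (y + 1), ih (y - 1)]

theorem walkExp_add (r : ℕ) (f g : ℝ → ℝ) (y : ℝ) :
    walkExp r (fun s => f s + g s) y = walkExp r f y + walkExp r g y := by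
  induction r generalizing y with
  | zero => rfl
  | succ r ih => simp only [walkExp, ih]; ring

theorem walkExp_mul_left (r : ℕ) (c : ℝ) (f : ℝ → ℝ) (y : ℝ) :
    walkExp r (fun s => c * f s) y = c * walkExp r f y := by
  induction r generalizing y with
  | zero => rfl
  | succ r ih => simp only [walkExp, ih]; ring

theorem walkExp_const (r : ℕ) (c y : ℝ) : walkExp r (fun _ => c) y = c := by
  induction r generalizing y with
  | zero => rfl
  | succ r ih => simp only [walkExp, ih]; ring

theorem exp_neg_le_quadratic {u : ℝ} (hu : 0 ≤ u) : Real.exp (-u) ≤ 1 - u + u ^ 2 / 2 := by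
  have h := Real.quadratic_le_exp_of_nonneg hu
  have h2 : 0 < Real.exp u := Real.exp_pos u
  rw [Real.exp_neg, inv_le_iff_one_le_mul₀ h2]
  have h3 : 0 < 1 - u + u ^ 2 / 2 := by nlinarith [sq_nonneg (u - 1)]
  calc (1 : ℝ) ≤ (1 - u + u ^ 2 / 2) * (1 + u + u ^ 2 / 2) := by nlinarith [sq_nonneg (u ^ 2)]
    _ ≤ _ := mul_le_mul_of_nonneg_left h h3.le

/-- Anti-concentration of the simple random walk in exponential form. -/
theorem walkExp_exp_le {m : ℕ} {r : ℝ} (hr : 0 < r) (h1 : r ≤ 2 * m) (h2 : (m : ℝ) ≤ r) (a : ℝ) :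
    walkExp m (fun s => Real.exp (1 / 16 - (s - a) ^ 2 / (3 * r))) 0 ≤ 1 := by
  set f : ℝ → ℝ := fun s => Real.exp (1 / 16 - (s - a) ^ 2 / (3 * r)) with hf
  have hsym : walkExp m f 0 = walkExp m (fun s => (1 / 2) * (f s + f (-s))) 0 := by
    rw [walkExp_mul_left, walkExp_add m f (fun s => f (-s)), walkExp_neg, neg_zero]; ring
  have hpt : ∀ s, (1 / 2) * (f s + f (-s)) ≤ Real.exp (1 / 16) *
      (1 + (-(1 / (6 * r)) * s ^ 2 + (1 / (36 * r ^ 2)) * s ^ 4)) := by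
    intro s
    have hq : Real.exp (-(s ^ 2 / (3 * r))) ≤ 1 - s ^ 2 / (3 * r) + (s ^ 2 / (3 * r)) ^ 2 / 2 :=
      exp_neg_le_quadratic (by positivity)
    have hone : ∀ w, Real.exp (-((w : ℝ) ^ 2 / (3 * r))) ≤ 1 := fun w =>
      Real.exp_le_one_iff.2 (neg_nonpos.2 (by positivity))
    have hbig : ∀ w : ℝ, s ^ 2 ≤ w ^ 2 → Real.exp (-(w ^ 2 / (3 * r))) ≤
        Real.exp (-(s ^ 2 / (3 * r))) := fun w hw => by
      apply Real.exp_le_exp.2; apply neg_le_neg; gcongr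
    have hsum : Real.exp (-((s - a) ^ 2 / (3 * r))) + Real.exp (-((-s - a) ^ 2 / (3 * r))) ≤
        1 + Real.exp (-(s ^ 2 / (3 * r))) := by
      rcases le_total 0 (s * a) with h | h
      · linarith [hone (s - a), hbig (-s - a) (by nlinarith [sq_nonneg a])]
      · linarith [hone (-s - a), hbig (s - a) (by nlinarith [sq_nonneg a])]
    have e1 : ∀ w, f w = Real.exp (1 / 16) * Real.exp (-((w - a) ^ 2 / (3 * r))) := fun w => by
      rw [hf, ← Real.exp_add]; ring_nf
    have e2 : 1 + (-(1 / (6 * r)) * s ^ 2 + (1 / (36 * r ^ 2)) * s ^ 4) =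
        (1 / 2) * (1 + (1 - s ^ 2 / (3 * r) + (s ^ 2 / (3 * r)) ^ 2 / 2)) := by
      field_simp; ring
    rw [e1, e1, e2]
    calc _ = Real.exp (1 / 16) * ((1 / 2) * (Real.exp (-((s - a) ^ 2 / (3 * r))) +
          Real.exp (-((-s - a) ^ 2 / (3 * r))))) := by ring
      _ ≤ _ := by
        refine mul_le_mul_of_nonneg_left ?_ (Real.exp_pos _).le
        linarith
  have hE : walkExp m (fun s => Real.exp (1 / 16) *
      (1 + (-(1 / (6 * r)) * s ^ 2 + (1 / (36 * r ^ 2)) * s ^ 4))) 0 =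
      Real.exp (1 / 16) * (1 + (-(1 / (6 * r)) * m + (1 / (36 * r ^ 2)) * (3 * m ^ 2 - 2 * m))) := by
    rw [walkExp_mul_left, walkExp_add, walkExp_add, walkExp_mul_left, walkExp_mul_left,
      walkExp_const, walkExp_sq, walkExp_four]
    norm_num
  rw [hsym]
  refine (walkExp_mono hpt 0).trans ?_
  rw [hE]
  have hρ : 1 + (-(1 / (6 * r)) * m + (1 / (36 * r ^ 2)) * (3 * m ^ 2 - 2 * m)) ≤ 15 / 16 := by
    have hm : (0 : ℝ) ≤ m := Nat.cast_nonneg m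
    set ρ : ℝ := m / r with hρ
    have h1' : 1 / 2 ≤ ρ := by rw [hρ, le_div_iff₀ hr]; linarith
    have h2' : ρ ≤ 1 := by rw [hρ, div_le_iff₀ hr]; linarith
    have : 1 + (-(1 / (6 * r)) * m + (1 / (36 * r ^ 2)) * (3 * m ^ 2 - 2 * m)) =
        1 - ρ / 6 + ρ ^ 2 / 12 - m / (18 * r ^ 2) := by
      rw [hρ]; field_simp; ring
    rw [this]
    have : 0 ≤ m / (18 * r ^ 2) := by positivity
    nlinarith
  have hexp : Real.exp (1 / 16) * (15 / 16) ≤ 1 := by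
    have := Real.add_one_le_exp (-(1 / 16) : ℝ)
    have h3 : Real.exp (1 / 16) * Real.exp (-(1 / 16)) = 1 := by rw [← Real.exp_add]; simp
    nlinarith [Real.exp_pos (1 / 16 : ℝ)]
  refine le_trans ?_ hexp
  gcongr

/-- A simple random walk from `y` with `r` steps hits the negative half-line with probability at
most `exp (-λ y) cosh (λ) ^ r`. -/
theorem coinExp_exists_neg_le {lam : ℝ} (hlam : 0 ≤ lam) (u r : ℕ) (y : ℝ) (x : ℕ → Bool) :
    coinExp u r (fun x => if ∃ m, u ≤ m ∧ m ≤ u + r ∧ y + seg u m x < 0 then 1 else 0) x ≤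
      Real.exp (-(lam * y)) * Real.cosh lam ^ r := by
  induction r generalizing u y x with
  | zero =>
    simp only [coinExp]
    split_ifs with h
    · obtain ⟨m, h1, h2, h3⟩ := h
      obtain rfl : m = u := by omega
      rw [seg_self] at h3
      simp only [pow_zero, mul_one]
      exact Real.one_le_exp (by nlinarith)
    · positivity
  | succ r ih =>
    by_cases hy : y < 0
    · calc _ ≤ coinExp u (r + 1) (fun _ => 1) x := coinExp_mono fun x' => by split_ifs <;> norm_num
        _ = 1 * 1 := by rw [coinExp_const]; norm_num
        _ ≤ _ := mul_le_mul (Real.one_le_exp (by nlinarith)) (one_le_pow₀ (Real.one_le_cosh lam))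
          zero_le_one (Real.exp_pos _).le
    · have key : ∀ b, coinExp (u + 1) r (fun x => if ∃ m, u ≤ m ∧ m ≤ u + (r + 1) ∧
          y + seg u m x < 0 then 1 else 0) (Function.update x u b) ≤
          Real.exp (-(lam * (y + coin b))) * Real.cosh lam ^ r := by
        intro b
        refine le_trans (le_of_eq ?_) (ih (u + 1) (y + coin b) (Function.update x u b))
        refine coinExp_congr fun x' hx' => ?_
        have hc : seg u (u + 1) x' = coin b := by simp [seg, hx' u (Nat.lt_succ_self u)]
        have : (∃ m, u ≤ m ∧ m ≤ u + (r + 1) ∧ y + seg u m x' < 0) ↔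
            ∃ m, u + 1 ≤ m ∧ m ≤ u + 1 + r ∧ y + coin b + seg (u + 1) m x' < 0 := by
          constructor
          · rintro ⟨m, h1, h2, h3⟩
            rcases Nat.eq_or_lt_of_le h1 with rfl | h1
            · rw [seg_self] at h3; exact absurd (by linarith) hy
            · refine ⟨m, h1, by omega, ?_⟩
              rw [seg_add (Nat.le_succ u) h1, Nat.succ_eq_add_one, hc] at h3
              linarith
          · rintro ⟨m, h1, h2, h3⟩
            refine ⟨m, by omega, by omega, ?_⟩
            rw [seg_add (Nat.le_succ u) h1, Nat.succ_eq_add_one, hc]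
            linarith
        simp only [this]
      have h1 := key true
      have h0 := key false
      have e : Real.exp (-(lam * y)) * Real.cosh lam ^ (r + 1) =
          1 / 2 * (Real.exp (-(lam * (y + coin true))) * Real.cosh lam ^ r) +
          1 / 2 * (Real.exp (-(lam * (y + coin false))) * Real.cosh lam ^ r) := by
        rw [pow_succ, Real.cosh_eq lam, show coin true = 1 by simp [coin],
          show coin false = -1 by simp [coin],
          show -(lam * (y + 1)) = -(lam * y) + -lam by ring,
          show -(lam * (y + -1)) = -(lam * y) + lam by ring, Real.exp_add, Real.exp_add]
        ring
      rw [e]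
      simp only [coinExp, Fintype.sum_bool]
      exact add_le_add (mul_le_mul_of_nonneg_left h1 (by norm_num))
        (mul_le_mul_of_nonneg_left h0 (by norm_num))

section Kernel

variable {Z : Type} [Fintype Z] {q : ℕ → Bool → Z → Z → ℝ}

/-- `q j b` is a stochastic matrix for every step `j` and every bit `b`. -/
structure IsKernel (q : ℕ → Bool → Z → Z → ℝ) : Prop where
  nonneg : ∀ j b z z', 0 ≤ q j b z z'
  sum_one : ∀ j b z, ∑ z', q j b z z' = 1

theorem pathExp_succ (u r : ℕ) (F : Hist Z → ℝ) (h : Hist Z) :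
    pathExp q u (r + 1) F h = ∑ b, ∑ z, 1 / 2 * q u b (h.2 u) z *
      pathExp q (u + 1) r F (Function.update h.1 u b, Function.update h.2 (u + 1) z) := rfl

theorem pathExp_comp (u r r' : ℕ) (F : Hist Z → ℝ) :
    pathExp q u (r + r') F = pathExp q u r (pathExp q (u + r) r' F) := by
  induction r generalizing u with
  | zero => simp [pathExp]
  | succ r ih =>
    rw [show r + 1 + r' = (r + r') + 1 by ring]
    simp only [pathExp, LinearMap.comp_apply, ih]
    rw [show u + 1 + r = u + (r + 1) by ring]

theorem pathExp_comp' {u s t : ℕ} (h : u ≤ s) (h' : s ≤ t) (F : Hist Z → ℝ) :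
    pathExp q u (t - u) F = pathExp q u (s - u) (pathExp q s (t - s) F) := by
  have := pathExp_comp (q := q) u (s - u) (t - s) F
  rwa [show s - u + (t - s) = t - u by omega, show u + (s - u) = s by omega] at this

theorem pathExp_mono (hq : IsKernel q) {u r : ℕ} {F F' : Hist Z → ℝ} {h : Hist Z}
    (H : ∀ h', Agree u h' h → F h' ≤ F' h') : pathExp q u r F h ≤ pathExp q u r F' h := by
  induction r generalizing u h with
  | zero => exact H h (agree_refl u h)
  | succ r ih =>
    rw [pathExp_succ, pathExp_succ]
    refine Finset.sum_le_sum fun b _ => Finset.sum_le_sum fun z _ => ?_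
    refine mul_le_mul_of_nonneg_left (ih fun h' hh' => H h' hh'.of_update.1) ?_
    have := hq.nonneg u b (h.2 u) z
    positivity

theorem pathExp_congr_past {u r : ℕ} {F F' : Hist Z → ℝ} {h : Hist Z}
    (H : ∀ h', Agree u h' h → F h' = F' h') : pathExp q u r F h = pathExp q u r F' h := by
  induction r generalizing u h with
  | zero => exact H h (agree_refl u h)
  | succ r ih =>
    rw [pathExp_succ, pathExp_succ]
    refine Finset.sum_congr rfl fun b _ => Finset.sum_congr rfl fun z _ => ?_
    rw [ih fun h' hh' => H h' hh'.of_update.1]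

/-- The Markov property: the law of the future depends on the past only through the present
state. -/
theorem pathExp_markov {u r : ℕ} {F F' : Hist Z → ℝ} {h₁ h₂ : Hist Z} (h₀ : h₁.2 u = h₂.2 u)
    (H : ∀ h₁' h₂', Agree u h₁' h₁ → Agree u h₂' h₂ →
      (∀ j, u ≤ j → j < u + r → h₁'.1 j = h₂'.1 j) →
      (∀ j, u ≤ j → j ≤ u + r → h₁'.2 j = h₂'.2 j) → F h₁' = F' h₂') :
    pathExp q u r F h₁ = pathExp q u r F' h₂ := by
  induction r generalizing u h₁ h₂ with
  | zero =>
    refine H h₁ h₂ (agree_refl _ _) (agree_refl _ _) (fun j _ _ => by omega) fun j h1 h2 => ?_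
    obtain rfl : j = u := by omega
    exact h₀
  | succ r ih =>
    rw [pathExp_succ, pathExp_succ, h₀]
    refine Finset.sum_congr rfl fun b _ => Finset.sum_congr rfl fun z _ => ?_
    congr 1
    refine ih (by simp) fun h₁' h₂' a₁ a₂ hx hz => ?_
    obtain ⟨a₁, e₁, f₁⟩ := a₁.of_update
    obtain ⟨a₂, e₂, f₂⟩ := a₂.of_update
    refine H h₁' h₂' a₁ a₂ (fun j h1 h2 => ?_) (fun j h1 h2 => ?_)
    · rcases Nat.eq_or_lt_of_le h1 with rfl | h1
      · rw [e₁, e₂]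
      · exact hx j h1 (by omega)
    · rcases Nat.eq_or_lt_of_le h1 with rfl | h1
      · rw [a₁.2 u le_rfl, a₂.2 u le_rfl, h₀]
      · exact hz j h1 (by omega)

theorem pathExp_mul_past {u r : ℕ} {F G : Hist Z → ℝ} {h : Hist Z}
    (H : ∀ h', Agree u h' h → G h' = G h) :
    pathExp q u r (fun h' => G h' * F h') h = G h * pathExp q u r F h := by
  rw [pathExp_congr_past (F' := G h • F) fun h' hh' => ?_]
  · simp
  · simp [H h' hh']

theorem stateExp_mul_left (x : ℕ → Bool) (u r : ℕ) (c : ℝ) (G : Z → ℝ) (z : Z) :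
    stateExp q x u r (fun z => c * G z) z = c * stateExp q x u r G z := by
  induction r generalizing u z with
  | zero => rfl
  | succ r ih =>
    simp only [stateExp, ih, Finset.mul_sum]
    exact Finset.sum_congr rfl fun _ _ => by ring

theorem stateExp_const (hq : IsKernel q) (x : ℕ → Bool) (u r : ℕ) (c : ℝ) (z : Z) :
    stateExp q x u r (fun _ => c) z = c := by
  induction r generalizing u z with
  | zero => rfl
  | succ r ih => simp only [stateExp, ih, ← Finset.sum_mul, hq.sum_one, one_mul]

theorem pathExp_state (u r : ℕ) (F : (ℕ → Bool) → Z → ℝ) (h : Hist Z) :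
    pathExp q u r (fun h => F h.1 (h.2 (u + r))) h =
      coinExp u r (fun x => stateExp q x u r (F x) (h.2 u)) h.1 := by
  induction r generalizing u h with
  | zero => rfl
  | succ r ih =>
    rw [pathExp_succ]
    simp only [coinExp]
    refine Finset.sum_congr rfl fun b _ => ?_
    have e : ∀ z, pathExp q (u + 1) r (fun h => F h.1 (h.2 (u + (r + 1))))
        (Function.update h.1 u b, Function.update h.2 (u + 1) z) =
        coinExp (u + 1) r (fun x => stateExp q x (u + 1) r (F x) z) (Function.update h.1 u b) := by
      intro z
      rw [show u + (r + 1) = u + 1 + r by ring, ih]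
      simp
    simp only [e]
    have e2 : coinExp (u + 1) r (fun x => stateExp q x u (r + 1) (F x) (h.2 u))
        (Function.update h.1 u b) = coinExp (u + 1) r (fun x => ∑ z', q u b (h.2 u) z' *
          stateExp q x (u + 1) r (F x) z') (Function.update h.1 u b) := by
      refine coinExp_congr fun x' hx' => ?_
      simp only [stateExp]
      rw [hx' u (Nat.lt_succ_self u)]
      simp
    rw [e2, coinExp_sum, Finset.mul_sum]
    refine Finset.sum_congr rfl fun z _ => ?_
    rw [coinExp_mul_left]; ring

theorem pathExp_coin (hq : IsKernel q) (u r : ℕ) (f : (ℕ → Bool) → ℝ) (h : Hist Z) :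
    pathExp q u r (fun h => f h.1) h = coinExp u r f h.1 := by
  rw [pathExp_state u r (fun x _ => f x) h]
  simp only [stateExp_const hq]

theorem pathExp_const (hq : IsKernel q) (u r : ℕ) (c : ℝ) (h : Hist Z) :
    pathExp q u r (fun _ => c) h = c := by
  rw [pathExp_coin hq u r (fun _ => c) h, coinExp_const]

end Kernel

/-- A one-pass program with an unnormalised starting distribution and a final acceptance weight,
such that the total accepted mass is one on every input. -/
structure Program (Z : Type) [Fintype Z] where
  q : ℕ → Bool → Z → Z → ℝ
  kernel : IsKernel q
  start : Z → ℝ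
  start_nonneg : ∀ z, 0 ≤ start z
  acc : Z → ℝ
  acc_nonneg : ∀ z, 0 ≤ acc z
  acc_le_one : ∀ z, acc z ≤ 1
  len : ℕ
  total : ∀ x, ∑ z, start z * stateExp q x 0 len acc z = 1

namespace Program

variable {Z : Type} [Fintype Z] (A : Program Z)

/-- The history that is constantly equal to `z`. -/
def base (z : Z) : Hist Z := (fun _ => true, fun _ => z)

/-- The expectation over accepted runs on uniformly random input. -/
def expect (F : Hist Z → ℝ) : ℝ :=
  ∑ z, A.start z * pathExp A.q 0 A.len (fun h => F h * A.acc (h.2 A.len)) (base z)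

theorem expect_add (F G : Hist Z → ℝ) :
    A.expect (fun h => F h + G h) = A.expect F + A.expect G := by
  have : ∀ z, pathExp A.q 0 A.len (fun h => (F h + G h) * A.acc (h.2 A.len)) (base z) =
      pathExp A.q 0 A.len (fun h => F h * A.acc (h.2 A.len)) (base z) +
      pathExp A.q 0 A.len (fun h => G h * A.acc (h.2 A.len)) (base z) := fun z => by
    rw [← Pi.add_apply, ← map_add]
    refine congrFun (congrArg _ (funext fun h => ?_)) _
    simp [add_mul]
  simp only [expect, this, mul_add, Finset.sum_add_distrib]

theorem expect_mul_left (c : ℝ) (F : Hist Z → ℝ) :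
    A.expect (fun h => c * F h) = c * A.expect F := by
  have : ∀ z, pathExp A.q 0 A.len (fun h => c * F h * A.acc (h.2 A.len)) (base z) =
      c * pathExp A.q 0 A.len (fun h => F h * A.acc (h.2 A.len)) (base z) := fun z => by
    rw [← smul_eq_mul c, ← Pi.smul_apply, ← map_smul]
    refine congrFun (congrArg _ (funext fun h => ?_)) _
    simp [mul_assoc]
  simp only [expect, this, Finset.mul_sum]
  exact Finset.sum_congr rfl fun _ _ => by ring

theorem expect_mono {F G : Hist Z → ℝ} (h : ∀ w, F w ≤ G w) : A.expect F ≤ A.expect G := by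
  refine Finset.sum_le_sum fun z _ => mul_le_mul_of_nonneg_left ?_ (A.start_nonneg z)
  exact pathExp_mono A.kernel fun h' _ => mul_le_mul_of_nonneg_right (h h') (A.acc_nonneg _)

theorem expect_state (F : (ℕ → Bool) → Z → ℝ) :
    A.expect (fun h => F h.1 (h.2 A.len)) = coinExp 0 A.len (fun x => ∑ z, A.start z *
      stateExp A.q x 0 A.len (fun z' => F x z' * A.acc z') z) fun _ => true := by
  have := fun z => pathExp_state (q := A.q) 0 A.len (fun x z' => F x z' * A.acc z') (base z)
  simp only [zero_add] at this
  simp only [expect, this, coinExp_sum, coinExp_mul_left]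
  rfl

theorem expect_coin (f : (ℕ → Bool) → ℝ) :
    A.expect (fun h => f h.1) = coinExp 0 A.len f fun _ => true := by
  rw [A.expect_state fun x _ => f x]
  refine coinExp_congr fun x _ => ?_
  simp only [stateExp_mul_left]
  calc _ = f x * ∑ z, A.start z * stateExp A.q x 0 A.len A.acc z := by
        rw [Finset.mul_sum]; exact Finset.sum_congr rfl fun _ _ => by ring
    _ = _ := by rw [A.total, mul_one]

theorem expect_const (c : ℝ) : A.expect (fun _ => c) = c := by
  rw [A.expect_coin fun _ => c, coinExp_const]

theorem expect_nonneg {F : Hist Z → ℝ} (h : ∀ w, 0 ≤ F w) : 0 ≤ A.expect F := by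
  rw [← A.expect_const 0]; exact A.expect_mono h

theorem expect_sum {ι : Type} (s : Finset ι) (F : ι → Hist Z → ℝ) :
    A.expect (fun h => ∑ i ∈ s, F i h) = ∑ i ∈ s, A.expect (F i) := by
  induction s using Finset.induction_on with
  | empty => simpa using A.expect_const 0
  | insert i s hi ih => simp only [Finset.sum_insert hi, expect_add, ih]

end Program

theorem coinExp_seg_mid {u t n : ℕ} (hu : u ≤ t) (ht : t ≤ n) (f : ℝ → ℝ) (x : ℕ → Bool) :
    coinExp 0 n (fun x => f (seg u t x)) x = walkExp (t - u) f 0 := by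
  have h1 : n = u + ((t - u) + (n - t)) := by omega
  rw [h1, coinExp_comp, zero_add]
  have : ∀ x, coinExp u (t - u + (n - t)) (fun x => f (seg u t x)) x = walkExp (t - u) f 0 := by
    intro x
    have h2 : u + (t - u) = t := by omega
    rw [coinExp_comp, ← coinExp_seg u (t - u) f 0 x, h2]
    refine coinExp_congr fun x' _ => ?_
    rw [zero_add, ← coinExp_const t (n - t) (f (seg u t x')) x']
    refine coinExp_congr fun x'' hx'' => ?_
    rw [seg_congr fun j _ hj => hx'' j hj]
  calc _ = coinExp 0 u (fun _ => walkExp (t - u) f 0) x := by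
        refine coinExp_congr fun x' _ => this x'
    _ = _ := coinExp_const _ _ _ _

namespace Program

variable {Z : Type} [Fintype Z] (A : Program Z)

theorem expect_seg {u t : ℕ} (hu : u ≤ t) (ht : t ≤ A.len) (f : ℝ → ℝ) :
    A.expect (fun h => f (seg u t h.1)) = walkExp (t - u) f 0 := by
  rw [A.expect_coin fun x => f (seg u t x), coinExp_seg_mid hu ht]

/-- The conditional expectation of `seg u s` given the states `z` at time `u` and `z'` at time
`s`. -/
def guess (u s : ℕ) (z z' : Z) : ℝ :=
  pathExp A.q u (s - u) (fun h => seg u s h.1 * if h.2 s = z' then 1 else 0) (base z) /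
    pathExp A.q u (s - u) (fun h => if h.2 s = z' then 1 else 0) (base z)

theorem guess_spec {u s : ℕ} (hus : u ≤ s) (z' : Z) (h : Hist Z) :
    pathExp A.q u (s - u) (fun h => seg u s h.1 * if h.2 s = z' then 1 else 0) h =
      A.guess u s (h.2 u) z' *
        pathExp A.q u (s - u) (fun h => if h.2 s = z' then 1 else 0) h := by
  have e1 : pathExp A.q u (s - u) (fun h => seg u s h.1 * if h.2 s = z' then 1 else 0) h =
      pathExp A.q u (s - u) (fun h => seg u s h.1 * if h.2 s = z' then 1 else 0)
        (base (h.2 u)) := by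
    refine pathExp_markov rfl fun h₁ h₂ _ _ hx hz => ?_
    rw [hz s hus (by omega), seg_congr fun j h1 h2 => hx j h1 (by omega)]
  have e2 : pathExp A.q u (s - u) (fun h => if h.2 s = z' then (1 : ℝ) else 0) h =
      pathExp A.q u (s - u) (fun h => if h.2 s = z' then 1 else 0) (base (h.2 u)) := by
    refine pathExp_markov rfl fun h₁ h₂ _ _ hx hz => ?_
    rw [hz s hus (by omega)]
  rw [e1, e2, guess]
  by_cases h0 : pathExp A.q u (s - u) (fun h => if h.2 s = z' then (1 : ℝ) else 0)
      (base (h.2 u)) = 0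
  · rw [h0, mul_zero]
    have hb : ∀ c : ℝ, pathExp A.q u (s - u) (fun h => c * if h.2 s = z' then (1 : ℝ) else 0)
        (base (h.2 u)) = 0 := fun c => by
      rw [pathExp_mul_past (G := fun _ => c) fun _ _ => rfl, h0, mul_zero]
    refine le_antisymm ?_ ?_
    · refine le_of_le_of_eq ?_ (hb ((s - u : ℕ) : ℝ))
      refine pathExp_mono A.kernel fun h' _ => mul_le_mul_of_nonneg_right ?_ ?_
      · exact (le_abs_self _).trans (abs_seg_le u s h'.1)
      · split_ifs <;> norm_num
    · refine le_of_eq_of_le (hb (-((s - u : ℕ) : ℝ))).symm ?_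
      refine pathExp_mono A.kernel fun h' _ => mul_le_mul_of_nonneg_right ?_ ?_
      · exact (neg_le_neg (abs_seg_le u s h'.1)).trans (neg_abs_le _)
      · split_ifs <;> norm_num
  · rw [div_mul_cancel₀ _ h0]

/-- The error of predicting `seg u s` from the states at times `u` and `s`. -/
def dev (u s : ℕ) (h : Hist Z) : ℝ := seg u s h.1 - A.guess u s (h.2 u) (h.2 s)

theorem pathExp_dev_mul {u s : ℕ} (hus : u ≤ s) (w : Z → ℝ) (h : Hist Z) :
    pathExp A.q u (s - u) (fun h => A.dev u s h * w (h.2 s)) h = 0 := by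
  have e : pathExp A.q u (s - u) (fun h => A.dev u s h * w (h.2 s)) h =
      pathExp A.q u (s - u) (∑ z', w z' • ((fun h : Hist Z => seg u s h.1 *
        if h.2 s = z' then (1 : ℝ) else 0) - A.guess u s (h.2 u) z' •
        (fun h : Hist Z => if h.2 s = z' then (1 : ℝ) else 0))) h := by
    refine pathExp_congr_past fun h' hh' => ?_
    simp only [Finset.sum_apply, Pi.smul_apply, Pi.sub_apply, smul_eq_mul, dev, hh'.2 u le_rfl]
    rw [Finset.sum_eq_single (h'.2 s)]
    · simp; ring
    · intro z _ hz; simp [Ne.symm hz]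
    · simp
  rw [e]
  simp only [map_sum, map_smul, map_sub, Finset.sum_apply, Pi.smul_apply, Pi.sub_apply,
    smul_eq_mul, A.guess_spec hus, sub_self, mul_zero, Finset.sum_const_zero]

/-- The prediction error is orthogonal to everything outside its window. -/
theorem expect_dev_mul {u s : ℕ} (hus : u ≤ s) (hs : s ≤ A.len) {B : Hist Z → ℝ}
    (hB : ∀ h₁ h₂ : Hist Z, (∀ j < A.len, j < u ∨ s ≤ j → h₁.1 j = h₂.1 j) →
      (∀ j ≤ A.len, j ≤ u ∨ s ≤ j → h₁.2 j = h₂.2 j) → B h₁ = B h₂) :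
    A.expect (fun h => A.dev u s h * B h) = 0 := by
  refine Finset.sum_eq_zero fun z _ => mul_eq_zero_of_right _ ?_
  generalize base z = h₀
  have hc := pathExp_comp' (q := A.q) (Nat.zero_le u) (hus.trans hs)
    (fun h => A.dev u s h * B h * A.acc (h.2 A.len))
  simp only [Nat.sub_zero] at hc
  rw [hc]
  have hzero : pathExp A.q u (A.len - u) (fun h => A.dev u s h * B h * A.acc (h.2 A.len)) =
      fun _ => 0 := by
    funext h
    rw [pathExp_comp' hus hs]
    set W : Hist Z → ℝ := pathExp A.q s (A.len - s) fun h => B h * A.acc (h.2 A.len) with hW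
    have e1 : pathExp A.q s (A.len - s) (fun h => A.dev u s h * B h * A.acc (h.2 A.len)) =
        fun h => A.dev u s h * W h := by
      funext h
      simp only [mul_assoc]
      rw [pathExp_mul_past fun h' hh' => ?_]
      rw [dev, dev, hh'.2 u hus, hh'.2 s le_rfl, seg_congr fun j _ hj => hh'.1 j hj]
    rw [e1, ← A.pathExp_dev_mul hus (fun z => W (h.1, Function.update h.2 s z)) h]
    refine pathExp_congr_past fun h' hh' => ?_
    congr 1
    refine pathExp_markov (by simp) fun h₁ h₂ a₁ a₂ hx hz => ?_
    have hz' : ∀ j ≤ A.len, j ≤ u ∨ s ≤ j → h₁.2 j = h₂.2 j := by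
      intro j hj hj'
      by_cases hsj : s ≤ j
      · exact hz j hsj (by omega)
      · rw [a₁.2 j (by omega), a₂.2 j (by omega), hh'.2 j (by omega)]
        exact (Function.update_of_ne (by omega) _ _).symm
    rw [hB h₁ h₂ (fun j hj hj' => ?_) hz', hz' A.len le_rfl (Or.inr hs)]
    by_cases hsj : s ≤ j
    · exact hx j hsj (by omega)
    · rw [a₁.1 j (by omega), a₂.1 j (by omega), hh'.1 j (by omega)]
  rw [hzero, pathExp_const A.kernel]

end Program

namespace Program

variable {Z : Type} [Fintype Z] (A : Program Z)

/-- The mean squared error of the prediction of `seg u t` from the states at times `u` and `t`. -/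
def loss (u t : ℕ) : ℝ := A.expect fun h => A.dev u t h ^ 2

theorem loss_nonneg (u t : ℕ) : 0 ≤ A.loss u t := A.expect_nonneg fun _ => sq_nonneg _

theorem dev_congr {u t : ℕ} {h₁ h₂ : Hist Z} (hx : ∀ j, u ≤ j → j < t → h₁.1 j = h₂.1 j)
    (hu : h₁.2 u = h₂.2 u) (ht : h₁.2 t = h₂.2 t) : A.dev u t h₁ = A.dev u t h₂ := by
  rw [dev, dev, hu, ht, seg_congr hx]

theorem loss_add_le {u s t : ℕ} (hus : u ≤ s) (hst : s ≤ t) (ht : t ≤ A.len) :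
    A.loss u s + A.loss s t ≤ A.loss u t := by
  set C : Hist Z → ℝ := fun h => A.guess u s (h.2 u) (h.2 s) + A.guess s t (h.2 s) (h.2 t) -
    A.guess u t (h.2 u) (h.2 t) with hC
  have hd : ∀ h, A.dev u t h ^ 2 = A.dev u s h ^ 2 + (A.dev s t h ^ 2 + (C h ^ 2 +
      (2 * (A.dev u s h * (A.dev s t h + C h)) + 2 * (A.dev s t h * C h)))) := by
    intro h
    have : A.dev u t h = A.dev u s h + A.dev s t h + C h := by
      simp only [dev, hC, seg_add hus hst]; ring
    rw [this]; ring
  have hCc : ∀ h₁ h₂ : Hist Z, h₁.2 u = h₂.2 u → h₁.2 s = h₂.2 s → h₁.2 t = h₂.2 t →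
      C h₁ = C h₂ := fun h₁ h₂ e1 e2 e3 => by simp only [hC, e1, e2, e3]
  have o1 := A.expect_dev_mul hus (hst.trans ht) (B := fun h => A.dev s t h + C h)
    fun h₁ h₂ hx hz => by
      have e1 := hz u (by omega) (by omega)
      have e2 := hz s (by omega) (by omega)
      have e3 := hz t (by omega) (by omega)
      rw [A.dev_congr (fun j h1 h2 => hx j (by omega) (by omega)) e2 e3, hCc h₁ h₂ e1 e2 e3]
  have o2 := A.expect_dev_mul hst ht (B := C) fun h₁ h₂ hx hz =>
    hCc h₁ h₂ (hz u (by omega) (by omega)) (hz s (by omega) (by omega))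
      (hz t (by omega) (by omega))
  simp only [loss, hd, expect_add, expect_mul_left, o1, o2]
  linarith [A.expect_nonneg fun h => sq_nonneg (C h)]

theorem loss_le_expect {a : ℕ} (ha : a ≤ A.len) (g : Z → ℝ) :
    A.loss a A.len ≤ A.expect fun h => (seg a A.len h.1 - g (h.2 A.len)) ^ 2 := by
  set C : Hist Z → ℝ := fun h => A.guess a A.len (h.2 a) (h.2 A.len) - g (h.2 A.len) with hC
  have hd : ∀ h : Hist Z, (seg a A.len h.1 - g (h.2 A.len)) ^ 2 =
      A.dev a A.len h ^ 2 + (C h ^ 2 + 2 * (A.dev a A.len h * C h)) := by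
    intro h; simp only [dev, hC]; ring
  have o := A.expect_dev_mul ha le_rfl (B := C) fun h₁ h₂ _ hz => by
    simp only [hC, hz a (by omega) (by omega), hz A.len (by omega) (by omega)]
  simp only [loss, hd, expect_add, expect_mul_left, o]
  linarith [A.expect_nonneg fun h => sq_nonneg (C h)]

theorem loss_le_loss {a t : ℕ} (hat : a ≤ t) (ht : t ≤ A.len) : A.loss a t ≤ A.loss a A.len := by
  linarith [A.loss_add_le hat ht le_rfl, A.loss_nonneg t A.len]

theorem sum_loss_le {a r : ℕ} (har : a + r ≤ A.len) :
    ∑ u ∈ Finset.Ico a (A.len - r + 1), A.loss u (u + r) ≤ r * A.loss a A.len := by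
  have key : ∀ d, a + d + r ≤ A.len + 1 → ∑ u ∈ Finset.Ico a (a + d), A.loss u (u + r) ≤
      ∑ i ∈ Finset.range r, A.loss a (a + d + i) := by
    intro d
    induction d with
    | zero =>
      intro _
      simp only [add_zero, Finset.Ico_self, Finset.sum_empty]
      exact Finset.sum_nonneg fun _ _ => A.loss_nonneg _ _
    | succ d ih =>
      intro hd
      rw [← add_assoc, Finset.sum_Ico_succ_top (by omega)]
      have h1 := ih (by omega)
      have h2 := A.loss_add_le (u := a) (s := a + d) (t := a + d + r) (by omega) (by omega)
        (by omega)
      have h3 : ∑ i ∈ Finset.range r, A.loss a (a + d + 1 + i) + A.loss a (a + d) =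
          ∑ i ∈ Finset.range r, A.loss a (a + d + i) + A.loss a (a + d + r) := by
        rw [← Finset.sum_range_succ (fun i => A.loss a (a + d + i)), Finset.sum_range_succ']
        simp only [add_zero]
        congr 1
        exact Finset.sum_congr rfl fun i _ => by congr 1; ring
      linarith
  have h := key (A.len - r + 1 - a) (by omega)
  rw [show a + (A.len - r + 1 - a) = A.len - r + 1 by omega] at h
  refine h.trans ?_
  calc _ ≤ ∑ i ∈ Finset.range r, A.loss a A.len := Finset.sum_le_sum fun i hi => by
        rw [Finset.mem_range] at hi
        exact A.loss_le_loss (by omega) (by omega)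
    _ = _ := by simp

/-- Some time has small loss on all geometrically growing windows ending there, on average. -/
theorem exists_time {a L : ℕ} (h : a + 2 * 64 ^ L ≤ A.len) :
    ∃ t, a + 64 ^ L ≤ t ∧ t ≤ A.len ∧
      ∑ i ∈ Finset.range L, A.loss (t - 64 ^ (i + 1)) t / 64 ^ (i + 1) ≤
        2 * L * (A.loss a A.len / ((A.len - a : ℕ) : ℝ)) := by
  by_contra hcon
  push Not at hcon
  have hpos : 0 < 64 ^ L := by positivity
  set B : ℝ := 2 * L * (A.loss a A.len / ((A.len - a : ℕ) : ℝ)) with hB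
  have hB0 : 0 ≤ B := by have := A.loss_nonneg a A.len; positivity
  have h1 : ∑ t ∈ Finset.Ico (a + 64 ^ L) (A.len + 1), B <
      ∑ t ∈ Finset.Ico (a + 64 ^ L) (A.len + 1),
        ∑ i ∈ Finset.range L, A.loss (t - 64 ^ (i + 1)) t / 64 ^ (i + 1) := by
    refine Finset.sum_lt_sum_of_nonempty (by simp; omega) fun t ht => ?_
    rw [Finset.mem_Ico] at ht
    exact hcon t ht.1 (by omega)
  have h2 : ∑ t ∈ Finset.Ico (a + 64 ^ L) (A.len + 1),
      ∑ i ∈ Finset.range L, A.loss (t - 64 ^ (i + 1)) t / 64 ^ (i + 1) ≤ L * A.loss a A.len := by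
    rw [Finset.sum_comm]
    calc _ ≤ ∑ i ∈ Finset.range L, A.loss a A.len := Finset.sum_le_sum fun i hi => ?_
      _ = _ := by simp
    rw [Finset.mem_range] at hi
    have hle : 64 ^ (i + 1) ≤ 64 ^ L := Nat.pow_le_pow_right (by norm_num) hi
    set r := 64 ^ (i + 1) with hr
    have hr0 : 0 < r := by positivity
    rw [← Finset.sum_div, show (64 : ℝ) ^ (i + 1) = (r : ℝ) by rw [hr]; push_cast; rfl,
      div_le_iff₀ (by exact_mod_cast hr0), mul_comm (A.loss a A.len)]
    refine le_trans ?_ (A.sum_loss_le (a := a) (r := r) (by omega))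
    have e : ∑ t ∈ Finset.Ico (a + 64 ^ L) (A.len + 1), A.loss (t - r) t =
        ∑ u ∈ Finset.Ico (a + 64 ^ L - r) (A.len - r + 1), A.loss u (u + r) := by
      have hs := Finset.sum_Ico_add' (fun t => A.loss (t - r) t) (a + 64 ^ L - r)
        (A.len - r + 1) r
      rw [show a + 64 ^ L - r + r = a + 64 ^ L by omega,
        show A.len - r + 1 + r = A.len + 1 by omega] at hs
      rw [← hs]
      exact Finset.sum_congr rfl fun u _ => by simp
    rw [e]
    refine Finset.sum_le_sum_of_subset_of_nonneg ?_ fun _ _ _ => A.loss_nonneg _ _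
    exact Finset.Ico_subset_Ico (by omega) le_rfl
  have h3 : (L : ℝ) * A.loss a A.len ≤ ∑ t ∈ Finset.Ico (a + 64 ^ L) (A.len + 1), B := by
    simp only [Finset.sum_const, Nat.card_Ico, nsmul_eq_mul]
    have hn : (0 : ℝ) < ((A.len - a : ℕ) : ℝ) := by exact_mod_cast (by omega : 0 < A.len - a)
    have hc : ((A.len - a : ℕ) : ℝ) ≤ 2 * ((A.len + 1 - (a + 64 ^ L) : ℕ) : ℝ) := by
      exact_mod_cast (by omega : A.len - a ≤ 2 * (A.len + 1 - (a + 64 ^ L)))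
    calc (L : ℝ) * A.loss a A.len = ((A.len - a : ℕ) : ℝ) * (B / 2) := by
          rw [hB]; field_simp
      _ ≤ 2 * ((A.len + 1 - (a + 64 ^ L) : ℕ) : ℝ) * (B / 2) := by gcongr
      _ = _ := by ring
  linarith

/-- The exponent rating how well the final state `z` predicts the `i`-th window before `t`. -/
def score (t i : ℕ) (z : Z) (h : Hist Z) : ℝ :=
  1 / 16 - (seg (t - 64 ^ (i + 1)) (t - 64 ^ i) h.1 -
    A.guess (t - 64 ^ (i + 1)) t (h.2 (t - 64 ^ (i + 1))) z) ^ 2 / (3 * 64 ^ (i + 1))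

theorem pathExp_exp_score_le (t : ℕ) (z : Z) (L : ℕ) (hL : 64 ^ L ≤ t) (h : Hist Z) :
    pathExp A.q (t - 64 ^ L) (t - (t - 64 ^ L))
      (fun h => Real.exp (∑ i ∈ Finset.range L, A.score t i z h)) h ≤ 1 := by
  induction L generalizing h with
  | zero => simp [pathExp_const A.kernel]
  | succ L ih =>
    have hp : 64 ^ (L + 1) = 64 * 64 ^ L := by ring
    have hp0 : 0 < 64 ^ L := by positivity
    rw [pathExp_comp' (s := t - 64 ^ L) (by omega) (by omega)]
    have hm : ((t - 64 ^ L - (t - 64 ^ (L + 1)) : ℕ) : ℝ) = 63 * 64 ^ L := by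
      rw [show t - 64 ^ L - (t - 64 ^ (L + 1)) = 63 * 64 ^ L by omega]; push_cast; rfl
    calc _ ≤ pathExp A.q (t - 64 ^ (L + 1)) (t - 64 ^ L - (t - 64 ^ (L + 1)))
          (fun h => Real.exp (A.score t L z h)) h := by
          refine pathExp_mono A.kernel fun h' _ => ?_
          simp only [Finset.sum_range_succ_comm, Real.exp_add]
          rw [pathExp_mul_past fun h'' hh => ?_]
          · exact mul_le_of_le_one_right (Real.exp_pos _).le (ih (by omega) h')
          · rw [score, score, hh.2 _ (by omega), seg_congr fun j _ hj => hh.1 j hj]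
      _ = pathExp A.q (t - 64 ^ (L + 1)) (t - 64 ^ L - (t - 64 ^ (L + 1)))
          (fun h' => (fun s => Real.exp (1 / 16 - (s - A.guess (t - 64 ^ (L + 1)) t
            (h.2 (t - 64 ^ (L + 1))) z) ^ 2 / (3 * 64 ^ (L + 1))))
            (0 + seg (t - 64 ^ (L + 1)) (t - 64 ^ (L + 1) + (t - 64 ^ L - (t - 64 ^ (L + 1))))
              h'.1)) h := by
          refine pathExp_congr_past fun h' hh => ?_
          rw [show t - 64 ^ (L + 1) + (t - 64 ^ L - (t - 64 ^ (L + 1))) = t - 64 ^ L by omega]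
          simp only [score, hh.2 _ le_rfl, zero_add]
      _ ≤ 1 := by
          rw [pathExp_coin A.kernel _ _ (fun x => (fun s => Real.exp (1 / 16 - (s -
            A.guess (t - 64 ^ (L + 1)) t (h.2 (t - 64 ^ (L + 1))) z) ^ 2 / (3 * 64 ^ (L + 1))))
            (0 + seg (t - 64 ^ (L + 1)) (t - 64 ^ (L + 1) + (t - 64 ^ L - (t - 64 ^ (L + 1))))
              x))]
          refine (coinExp_seg _ _ (fun s => Real.exp (1 / 16 - (s -
            A.guess (t - 64 ^ (L + 1)) t (h.2 (t - 64 ^ (L + 1))) z) ^ 2 / (3 * 64 ^ (L + 1))))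
            0 _).le.trans ?_
          have h0 : (0 : ℝ) < 64 ^ L := by positivity
          refine walkExp_exp_le (by positivity) ?_ ?_ _
          · rw [hm, pow_succ]; linarith
          · rw [hm, pow_succ]; linarith

theorem expect_exp_score_le {t L : ℕ} (hL : 64 ^ L ≤ t) (ht : t ≤ A.len) :
    A.expect (fun h => Real.exp (∑ i ∈ Finset.range L, A.score t i (h.2 t) h)) ≤
      Fintype.card Z * ∑ z, A.start z := by
  rw [Finset.mul_sum]
  refine Finset.sum_le_sum fun z₀ _ => ?_
  rw [mul_comm (Fintype.card Z : ℝ)]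
  refine mul_le_mul_of_nonneg_left ?_ (A.start_nonneg z₀)
  have h1 : ∀ z h, pathExp A.q 0 A.len
      (fun h => Real.exp (∑ i ∈ Finset.range L, A.score t i z h)) h ≤ 1 := by
    intro z h
    have hc := pathExp_comp' (q := A.q) (Nat.zero_le (t - 64 ^ L)) ((Nat.sub_le _ _).trans ht)
      (fun h => Real.exp (∑ i ∈ Finset.range L, A.score t i z h))
    simp only [Nat.sub_zero] at hc
    rw [hc, pathExp_comp' (Nat.sub_le t (64 ^ L)) ht]
    have e : pathExp A.q t (A.len - t)
        (fun h => Real.exp (∑ i ∈ Finset.range L, A.score t i z h)) =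
        fun h => Real.exp (∑ i ∈ Finset.range L, A.score t i z h) := by
      funext h
      rw [← pathExp_const A.kernel t (A.len - t)
        (Real.exp (∑ i ∈ Finset.range L, A.score t i z h)) h]
      refine pathExp_congr_past fun h' hh => ?_
      congr 1
      refine Finset.sum_congr rfl fun i _ => ?_
      rw [score, score, hh.2 _ (Nat.sub_le _ _),
        seg_congr fun j _ hj => hh.1 j (lt_of_lt_of_le hj (Nat.sub_le _ _))]
    rw [e, ← pathExp_const A.kernel 0 (t - 64 ^ L) 1 h]
    exact pathExp_mono A.kernel fun h' _ => A.pathExp_exp_score_le t z L hL h'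
  calc _ ≤ pathExp A.q 0 A.len (∑ z, fun h : Hist Z =>
        Real.exp (∑ i ∈ Finset.range L, A.score t i z h)) (base z₀) := by
        refine pathExp_mono A.kernel fun h _ => ?_
        rw [Finset.sum_apply]
        refine (mul_le_of_le_one_right (Real.exp_pos _).le (A.acc_le_one _)).trans ?_
        exact Finset.single_le_sum (f := fun z => Real.exp (∑ i ∈ Finset.range L, A.score t i z h))
          (fun z _ => (Real.exp_pos _).le) (Finset.mem_univ (h.2 t))
    _ ≤ ∑ z : Z, (1 : ℝ) := by
        rw [map_sum, Finset.sum_apply]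
        exact Finset.sum_le_sum fun z _ => h1 z _
    _ = _ := by simp

theorem exp_expect_le (Y : Hist Z → ℝ) :
    Real.exp (A.expect Y) ≤ A.expect fun h => Real.exp (Y h) := by
  have h1 : ∀ h, Real.exp (A.expect Y) * Y h + Real.exp (A.expect Y) * (1 - A.expect Y) ≤
      Real.exp (Y h) := by
    intro h
    have h2 := Real.add_one_le_exp (Y h - A.expect Y)
    have h3 : Real.exp (Y h) = Real.exp (A.expect Y) * Real.exp (Y h - A.expect Y) := by
      rw [← Real.exp_add]; ring_nf
    rw [h3]
    nlinarith [Real.exp_pos (A.expect Y)]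
  refine le_trans (le_of_eq ?_) (A.expect_mono h1)
  rw [expect_add, expect_mul_left, expect_const]
  ring

theorem expect_score_ge {t i : ℕ} (hi : 64 ^ (i + 1) ≤ t) (ht : t ≤ A.len) :
    5 / 96 - A.loss (t - 64 ^ (i + 1)) t / 64 ^ (i + 1) ≤
      A.expect fun h => A.score t i (h.2 t) h := by
  have hp : 64 ^ (i + 1) = 64 * 64 ^ i := by ring
  have hp0 : (0 : ℝ) < 64 ^ i := by positivity
  have hpt : ∀ h, 1 / 16 + (-(2 / (3 * 64 ^ (i + 1))) * A.dev (t - 64 ^ (i + 1)) t h ^ 2 +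
      -(2 / (3 * 64 ^ (i + 1))) * seg (t - 64 ^ i) t h.1 ^ 2) ≤ A.score t i (h.2 t) h := by
    intro h
    have e : seg (t - 64 ^ (i + 1)) (t - 64 ^ i) h.1 -
        A.guess (t - 64 ^ (i + 1)) t (h.2 (t - 64 ^ (i + 1))) (h.2 t) =
        A.dev (t - 64 ^ (i + 1)) t h - seg (t - 64 ^ i) t h.1 := by
      rw [dev, seg_add (u := t - 64 ^ (i + 1)) (s := t - 64 ^ i) (t := t) (by omega) (by omega)]
      ring
    rw [score, e]
    set D := A.dev (t - 64 ^ (i + 1)) t h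
    set S := seg (t - 64 ^ i) t h.1
    have : (D - S) ^ 2 / (3 * 64 ^ (i + 1)) ≤ (2 * D ^ 2 + 2 * S ^ 2) / (3 * 64 ^ (i + 1)) := by
      gcongr; nlinarith [sq_nonneg (D + S)]
    calc _ = 1 / 16 - (2 * D ^ 2 + 2 * S ^ 2) / (3 * 64 ^ (i + 1)) := by ring
      _ ≤ _ := by linarith
  have h1 := A.expect_mono hpt
  rw [expect_add, expect_add, expect_mul_left, expect_mul_left, expect_const,
    A.expect_seg (Nat.sub_le _ _) ht (fun s => s ^ 2), walkExp_sq,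
    show t - (t - 64 ^ i) = 64 ^ i by omega] at h1
  refine le_trans ?_ h1
  have hl := A.loss_nonneg (t - 64 ^ (i + 1)) t
  rw [← loss]
  have e1 : -(2 / (3 * 64 ^ (i + 1))) * ((0 : ℝ) ^ 2 + ((64 ^ i : ℕ) : ℝ)) = -(1 / 96) := by
    push_cast; rw [pow_succ]; field_simp; norm_num; ring
  have e2 : -(2 / (3 * 64 ^ (i + 1))) * A.loss (t - 64 ^ (i + 1)) t =
      -(2 / 3) * (A.loss (t - 64 ^ (i + 1)) t / 64 ^ (i + 1)) := by
    field_simp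
  rw [e1, e2]
  have : 0 ≤ A.loss (t - 64 ^ (i + 1)) t / 64 ^ (i + 1) := by positivity
  linarith

/-- A program predicting the sum of the last `len - a` coins within a small fraction of its
variance needs many states. -/
theorem exp_le_card_mul {a L : ℕ} (h : a + 2 * 64 ^ L ≤ A.len)
    (hloss : A.loss a A.len ≤ ((A.len - a : ℕ) : ℝ) / 100) :
    Real.exp (L / 32) ≤ Fintype.card Z * ∑ z, A.start z := by
  obtain ⟨t, h1, h2, h3⟩ := A.exists_time h
  refine le_trans ?_ (A.expect_exp_score_le (by omega : 64 ^ L ≤ t) h2)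
  refine le_trans (Real.exp_le_exp.2 ?_) (A.exp_expect_le _)
  rw [expect_sum]
  have hpos : 0 < 64 ^ L := by positivity
  have hn : (0 : ℝ) < ((A.len - a : ℕ) : ℝ) := by exact_mod_cast (by omega : 0 < A.len - a)
  have h4 : A.loss a A.len / ((A.len - a : ℕ) : ℝ) ≤ 1 / 100 := by
    rw [div_le_iff₀ hn]; linarith
  have h5 : ∑ i ∈ Finset.range L, (5 / 96 - A.loss (t - 64 ^ (i + 1)) t / 64 ^ (i + 1)) ≤
      ∑ i ∈ Finset.range L, A.expect (fun h => A.score t i (h.2 t) h) := by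
    refine Finset.sum_le_sum fun i hi => A.expect_score_ge ?_ h2
    rw [Finset.mem_range] at hi
    have : 64 ^ (i + 1) ≤ 64 ^ L := Nat.pow_le_pow_right (by norm_num) hi
    omega
  refine le_trans ?_ h5
  rw [Finset.sum_sub_distrib]
  simp only [Finset.sum_const, Finset.card_range, nsmul_eq_mul]
  have hL : (0 : ℝ) ≤ L := Nat.cast_nonneg L
  nlinarith

end Program

section Law

variable {Ω : Type} [Fintype Ω] {p : Ω → ℝ} {𝒳 RO : Type} {n k : ℕ}

theorem pr_eq_sum_fiber {α : Type} [Fintype α] (X : Ω → α) (E : Ω → Prop) :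
    pr p E = ∑ a, pr p fun ω => X ω = a ∧ E ω := by
  simp only [pr]
  rw [Finset.sum_comm]
  refine Finset.sum_congr rfl fun ω _ => ?_
  by_cases h : E ω <;> simp [h]

theorem pr_and_const (E : Ω → Prop) (P : Prop) :
    pr p (fun ω => E ω ∧ P) = if P then pr p E else 0 := by
  by_cases h : P <;> simp [pr, h]

/-- The transition probabilities of step `j` of pass `i` on reading `b`. -/
def AlgD.transition (M : AlgD Ω p 𝒳 n k) (i j : ℕ) (b : 𝒳) (m m' : M.S) : ℝ :=
  pr p fun ω => M.f i j b m (M.R i j ω) = m'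

/-- `ini` has law `ν`, and is independent of the output randomness and of the seeds in `L`. -/
def AlgD.IsProduct (M : AlgD Ω p 𝒳 n k) (rout : Ω → RO) (L : Finset (ℕ × ℕ)) (ini : Ω → M.S)
    (ν : M.S → ℝ) : Prop :=
  ∀ (m : M.S) (r : ℕ → ℕ → M.Rv) (u : RO),
    pr p (fun ω => ini ω = m ∧ (∀ e ∈ L, M.R e.1 e.2 ω = r e.1 e.2) ∧ rout ω = u) =
      ν m * (∏ e ∈ L, pr p fun ω => M.R e.1 e.2 ω = r e.1 e.2) * pr p fun ω => rout ω = u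

theorem AlgD.transition_eq_sum (M : AlgD Ω p 𝒳 n k) (i j : ℕ) (b : 𝒳) (m m' : M.S) :
    M.transition i j b m m' =
      ∑ ρ, if M.f i j b m ρ = m' then pr p (fun ω => M.R i j ω = ρ) else 0 := by
  rw [transition, pr_eq_sum_fiber (M.R i j)]
  refine Finset.sum_congr rfl fun ρ _ => ?_
  rw [← pr_and_const]
  congr 1
  funext ω
  refine propext (and_congr_right fun h => ?_)
  rw [h]

theorem AlgD.IsProduct.step {M : AlgD Ω p 𝒳 n k} {rout : Ω → RO} {L : Finset (ℕ × ℕ)}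
    {ini : Ω → M.S} {ν : M.S → ℝ} {i j : ℕ} (h : M.IsProduct rout (insert (i, j) L) ini ν)
    (hij : (i, j) ∉ L) (b : 𝒳) :
    M.IsProduct rout L (fun ω => M.f i j b (ini ω) (M.R i j ω))
      fun m' => ∑ m, ν m * M.transition i j b m m' := by
  intro m' r u
  rw [pr_eq_sum_fiber ini, Finset.sum_mul, Finset.sum_mul]
  refine Finset.sum_congr rfl fun m _ => ?_
  rw [pr_eq_sum_fiber (M.R i j), transition_eq_sum, Finset.mul_sum, Finset.sum_mul, Finset.sum_mul]
  refine Finset.sum_congr rfl fun ρ _ => ?_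
  have h1 := h m (fun i' j' => if (i', j') = (i, j) then ρ else r i' j') u
  rw [Finset.prod_insert hij] at h1
  have h2 : ∀ e ∈ L, (if (e.1, e.2) = (i, j) then ρ else r e.1 e.2) = r e.1 e.2 := fun e he =>
    if_neg fun h3 => hij (by rw [← h3]; exact he)
  rw [Finset.prod_congr rfl fun e he => by rw [h2 e he]] at h1
  simp only [Finset.forall_mem_insert, if_true] at h1
  have h3 : (fun ω => M.R i j ω = ρ ∧ ini ω = m ∧ M.f i j b (ini ω) (M.R i j ω) = m' ∧
      (∀ e ∈ L, M.R e.1 e.2 ω = r e.1 e.2) ∧ rout ω = u) =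
      fun ω => (ini ω = m ∧ (M.R i j ω = ρ ∧ ∀ e ∈ L, M.R e.1 e.2 ω =
        if (e.1, e.2) = (i, j) then ρ else r e.1 e.2) ∧ rout ω = u) ∧ M.f i j b m ρ = m' := by
    funext ω
    have h4 : (∀ e ∈ L, M.R e.1 e.2 ω = if (e.1, e.2) = (i, j) then ρ else r e.1 e.2) ↔
        ∀ e ∈ L, M.R e.1 e.2 ω = r e.1 e.2 :=
      forall₂_congr fun e he => by rw [h2 e he]
    rw [h4]
    refine propext ⟨?_, ?_⟩
    · rintro ⟨rfl, rfl, h5, h6, h7⟩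
      exact ⟨⟨rfl, ⟨rfl, h6⟩, h7⟩, h5⟩
    · rintro ⟨⟨rfl, ⟨rfl, h6⟩, h7⟩, h5⟩
      exact ⟨rfl, rfl, h5, h6, h7⟩
  rw [h3, pr_and_const, h1]
  split_ifs
  · ring
  · simp

/-- The steps from step `j` of pass `i` on. -/
def later (k n i j : ℕ) : Finset (ℕ × ℕ) :=
  (Finset.range k ×ˢ Finset.range n).filter fun e => i < e.1 ∨ i = e.1 ∧ j ≤ e.2

theorem later_eq_insert {i j : ℕ} (hi : i < k) (hj : j < n) :
    later k n i j = insert (i, j) (later k n i (j + 1)) := by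
  ext ⟨a, b⟩
  simp only [later, Finset.mem_filter, Finset.mem_product, Finset.mem_range, Finset.mem_insert,
    Prod.mk.injEq]
  omega

theorem not_mem_later (i j : ℕ) : (i, j) ∉ later k n i (j + 1) := by
  simp [later]

theorem later_next (i : ℕ) : later k n i n = later k n (i + 1) 0 := by
  ext ⟨a, b⟩
  simp only [later, Finset.mem_filter, Finset.mem_product, Finset.mem_range]
  omega

theorem later_last : later k n k 0 = ∅ := by
  ext ⟨a, b⟩
  simp only [later, Finset.mem_filter, Finset.mem_product, Finset.mem_range,
    Finset.notMem_empty, iff_false]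
  omega

theorem later_zero : later k n 0 0 = Finset.range k ×ˢ Finset.range n := by
  ext ⟨a, b⟩
  simp only [later, Finset.mem_filter, Finset.mem_product, Finset.mem_range]
  omega

/-- The law after `j` steps of pass `i` started from the law `ν`. -/
def AlgD.runLaw (M : AlgD Ω p 𝒳 n k) (x : ℕ → 𝒳) (i : ℕ) (ν : M.S → ℝ) : ℕ → M.S → ℝ
  | 0 => ν
  | j + 1 => fun m' => ∑ m, M.runLaw x i ν j m * M.transition i j (x j) m m'

/-- The law of the memory state at the end of each pass. -/
def AlgD.passLaw (M : AlgD Ω p 𝒳 n k) (x : ℕ → 𝒳) : ℕ → M.S → ℝ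
  | 0 => fun m => pr p fun ω => M.init ω = m
  | i + 1 => M.runLaw x i (M.passLaw x i) n

theorem AlgD.isProduct_runPass {M : AlgD Ω p 𝒳 n k} {rout : Ω → RO} {x : ℕ → 𝒳} {i : ℕ}
    (hi : i < k) {ini : Ω → M.S} {ν : M.S → ℝ} (h : M.IsProduct rout (later k n i 0) ini ν)
    {j : ℕ} (hj : j ≤ n) :
    M.IsProduct rout (later k n i j) (M.runPass x i ini j) (M.runLaw x i ν j) := by
  induction j with
  | zero => exact h
  | succ j ih =>
    have h1 := ih (by omega)
    rw [later_eq_insert hi (by omega)] at h1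
    have h2 := h1.step (not_mem_later i j) (x j)
    simpa only [runPass, runLaw, hi, (by omega : j < n), and_self, if_true] using h2

theorem AlgD.isProduct_passEnd {M : AlgD Ω p 𝒳 n k} {rout : Ω → RO}
    (hout : ∀ (m : M.S) (r : ℕ → ℕ → M.Rv) (u : RO),
      pr p (fun ω => M.init ω = m ∧ (∀ i < k, ∀ j < n, M.R i j ω = r i j) ∧ rout ω = u) =
        pr p (fun ω => M.init ω = m ∧ ∀ i < k, ∀ j < n, M.R i j ω = r i j) *
          pr p fun ω => rout ω = u)
    (x : ℕ → 𝒳) {i : ℕ} (hi : i ≤ k) :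
    M.IsProduct rout (later k n i 0) (M.passEnd x i) (M.passLaw x i) := by
  induction i with
  | zero =>
    intro m r u
    have e : ∀ ω, (∀ e ∈ later k n 0 0, M.R e.1 e.2 ω = r e.1 e.2) ↔
        ∀ i < k, ∀ j < n, M.R i j ω = r i j := by
      intro ω
      rw [later_zero]
      simp only [Finset.mem_product, Finset.mem_range, Prod.forall]
      exact ⟨fun h i hi j hj => h i j ⟨hi, hj⟩, fun h i j hij => h i hij.1 j hij.2⟩
    simp only [e]
    rw [later_zero, Finset.prod_product]
    simp only [passEnd, passLaw]
    rw [hout, M.indep]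
  | succ i ih =>
    have := isProduct_runPass (x := x) (by omega) (ih (by omega)) le_rfl
    rw [later_next] at this
    exact this

/-- The joint law of the final state and the output randomness. -/
theorem AlgD.sum_final [Fintype RO] {M : AlgD Ω p 𝒳 n k} {rout : Ω → RO}
    (hout : ∀ (m : M.S) (r : ℕ → ℕ → M.Rv) (u : RO),
      pr p (fun ω => M.init ω = m ∧ (∀ i < k, ∀ j < n, M.R i j ω = r i j) ∧ rout ω = u) =
        pr p (fun ω => M.init ω = m ∧ ∀ i < k, ∀ j < n, M.R i j ω = r i j) *
          pr p fun ω => rout ω = u)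
    (x : ℕ → 𝒳) (F : M.S → RO → ℝ) :
    ∑ ω, p ω * F (M.final x ω) (rout ω) =
      ∑ u, pr p (fun ω => rout ω = u) * ∑ m, M.passLaw x k m * F m u := by
  have h := isProduct_passEnd hout x le_rfl
  rw [later_last] at h
  have h1 : ∀ m u, pr p (fun ω => M.final x ω = m ∧ rout ω = u) =
      M.passLaw x k m * pr p fun ω => rout ω = u := by
    intro m u
    by_cases hR : Nonempty M.Rv
    · simpa [final] using h m (fun _ _ => hR.some) u
    · have hΩ : IsEmpty Ω := ⟨fun ω => hR ⟨M.R 0 0 ω⟩⟩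
      simp [pr]
  calc _ = ∑ u, ∑ m, pr p (fun ω => M.final x ω = m ∧ rout ω = u) * F m u := by
        simp only [pr, Finset.sum_mul]
        rw [Finset.sum_congr rfl fun u _ => Finset.sum_comm, Finset.sum_comm]
        refine Finset.sum_congr rfl fun ω _ => ?_
        rw [Finset.sum_eq_single (rout ω), Finset.sum_eq_single (M.final x ω)]
        · simp
        · intro m _ hm; simp [hm.symm]
        · simp
        · intro u _ hu; simp [hu.symm]
        · simp
    _ = _ := by
        refine Finset.sum_congr rfl fun u _ => ?_
        rw [Finset.mul_sum]
        refine Finset.sum_congr rfl fun m _ => ?_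
        rw [h1]; ring

theorem AlgD.transition_nonneg (hp : IsPMF p) (M : AlgD Ω p 𝒳 n k) (i j : ℕ) (b : 𝒳)
    (m m' : M.S) : 0 ≤ M.transition i j b m m' :=
  Finset.sum_nonneg fun ω _ => by split_ifs <;> simp [hp.nonneg ω]

theorem sum_pr_eq_one (hp : IsPMF p) {α : Type} [Fintype α] (X : Ω → α) :
    ∑ a, pr p (fun ω => X ω = a) = 1 := by
  have := pr_eq_sum_fiber (p := p) X fun _ => True
  simp only [and_true] at this
  rw [← this]
  simp [pr, hp.sum_one]

theorem AlgD.sum_transition (hp : IsPMF p) (M : AlgD Ω p 𝒳 n k) (i j : ℕ) (b : 𝒳) (m : M.S) :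
    ∑ m', M.transition i j b m m' = 1 :=
  sum_pr_eq_one hp _

end Law

section Tensor

variable {S : Type} [Fintype S]

/-- Run `d` kernels in parallel on the same input, remembering the initial states. -/
def tensor {d : ℕ} (K : Fin d → ℕ → Bool → S → S → ℝ) (j : ℕ) (b : Bool)
    (z z' : (Fin d → S) × (Fin d → S)) : ℝ :=
  if z.1 = z'.1 then ∏ i, K i j b (z.2 i) (z'.2 i) else 0

theorem sum_tensor_mul {d : ℕ} (K : Fin d → ℕ → Bool → S → S → ℝ) (j : ℕ) (b : Bool)
    (z : (Fin d → S) × (Fin d → S)) (G : (Fin d → S) × (Fin d → S) → ℝ) :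
    ∑ z', tensor K j b z z' * G z' = ∑ m', (∏ i, K i j b (z.2 i) (m' i)) * G (z.1, m') := by
  rw [Fintype.sum_prod_type, Finset.sum_eq_single z.1]
  · simp [tensor]
  · intro g _ hg
    simp [tensor, hg.symm]
  · simp

theorem sum_prod_eq_prod_sum {d : ℕ} (F : Fin d → S → ℝ) :
    ∑ m : Fin d → S, ∏ i, F i (m i) = ∏ i, ∑ s, F i s := by
  rw [Finset.prod_univ_sum, Fintype.piFinset_univ]

theorem isKernel_tensor {d : ℕ} {K : Fin d → ℕ → Bool → S → S → ℝ} (hK : ∀ i, IsKernel (K i)) :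
    IsKernel (tensor K) where
  nonneg j b z z' := by
    unfold tensor
    split_ifs
    · exact Finset.prod_nonneg fun i _ => (hK i).nonneg _ _ _ _
    · exact le_rfl
  sum_one j b z := by
    have := sum_tensor_mul K j b z fun _ => 1
    simp only [mul_one] at this
    rw [this, sum_prod_eq_prod_sum]
    exact Finset.prod_eq_one fun i _ => (hK i).sum_one _ _ _

theorem stateExp_tensor {d : ℕ} (K : Fin d → ℕ → Bool → S → S → ℝ) (x : ℕ → Bool) (u r : ℕ)
    (G : (Fin d → S) × (Fin d → S) → ℝ) (z : (Fin d → S) × (Fin d → S)) :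
    stateExp (tensor K) x u r G z =
      ∑ m' : Fin d → S, (∏ i, stateExp (K i) x u r (fun s => if s = m' i then 1 else 0) (z.2 i)) *
        G (z.1, m') := by
  induction r generalizing u z with
  | zero =>
    simp only [stateExp, Finset.prod_ite_zero, Finset.prod_const_one, Finset.mem_univ,
      forall_true_left]
    rw [Finset.sum_eq_single z.2]
    · simp
    · intro m' _ hm
      rw [if_neg fun h => hm (funext fun i => (h i).symm), zero_mul]
    · simp
  | succ r ih =>
    simp only [stateExp]
    rw [sum_tensor_mul]
    simp only [ih, Finset.mul_sum, ← sum_prod_eq_prod_sum, Finset.prod_mul_distrib, Finset.sum_mul]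
    rw [Finset.sum_comm]
    exact Finset.sum_congr rfl fun m' _ => Finset.sum_congr rfl fun m _ => by ring

theorem sum_fin_cons {d : ℕ} (F : (Fin (d + 1) → S) → ℝ) :
    ∑ g, F g = ∑ a, ∑ g : Fin d → S, F (Fin.cons a g) := by
  rw [← Fintype.sum_prod_type' fun a g => F (Fin.cons a g)]
  exact (Fintype.sum_equiv (Fin.consEquiv fun _ => S) _ _ fun _ => rfl).symm

/-- Guessing the states between consecutive kernels and checking the guesses composes the
kernels. -/
theorem sum_chain (d : ℕ) (P : ℕ → S → S → ℝ) (ν : ℕ → S → ℝ)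
    (hν : ∀ i m', ν (i + 1) m' = ∑ m, ν i m * P i m m') (H : S → ℝ) :
    ∑ g : Fin (d + 1) → S, ∑ m : Fin (d + 1) → S, ν 0 (g 0) *
      ((∏ i : Fin (d + 1), P i (g i) (m i)) *
        (H (m (Fin.last d)) * ∏ i : Fin d, if m i.castSucc = g i.succ then 1 else 0)) =
      ∑ s, ν (d + 1) s * H s := by
  induction d generalizing P ν with
  | zero =>
    simp only [sum_fin_cons, hν 0]
    simp only [Finset.sum_mul]
    simp [mul_assoc]
    exact Finset.sum_comm
  | succ d ih =>
    rw [← ih (fun i => P (i + 1)) (fun i => ν (i + 1)) (fun i => hν (i + 1))]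
    rw [sum_fin_cons, Finset.sum_comm]
    refine Finset.sum_congr rfl fun g _ => ?_
    simp only [sum_fin_cons (d := d + 1)]
    simp only [Fin.prod_univ_succ (n := d + 1), Fin.prod_univ_succ (n := d), Fin.cons_zero,
      Fin.cons_succ, Fin.castSucc_zero, Fin.castSucc_succ, ← Fin.succ_last, Fin.val_zero,
      Fin.val_succ, zero_add]
    rw [Finset.sum_congr rfl fun a _ => Finset.sum_comm, Finset.sum_comm]
    refine Finset.sum_congr rfl fun m _ => ?_
    rw [Finset.sum_comm, Finset.sum_eq_single (g 0)]
    · rw [hν 0, Finset.sum_mul]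
      refine Finset.sum_congr rfl fun a _ => ?_
      simp
      ring
    · intro b _ hb
      simp [hb]
    · simp

end Tensor

section Program

variable {Ω : Type} [Fintype Ω] {p : Ω → ℝ} {n k : ℕ}

/-- Replace the first `a` updates by insertions. -/
def prepend (a : ℕ) (x : ℕ → Bool) (j : ℕ) : Bool := if j < a then true else x j

theorem AlgD.sum_runLaw_mul (M : AlgD Ω p Bool n k) (a : ℕ) (x : ℕ → Bool) (i : ℕ)
    (ν : M.S → ℝ) (j r : ℕ) (G : M.S → ℝ) :
    ∑ m, M.runLaw (prepend a x) i ν j m * stateExp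
        (fun j b => M.transition i j (if j < a then true else b)) x j r G m =
      ∑ m, ν m * stateExp
        (fun j b => M.transition i j (if j < a then true else b)) x 0 (j + r) G m := by
  induction j generalizing r with
  | zero => simp [runLaw]
  | succ j ih =>
    rw [show j + 1 + r = j + (r + 1) by ring, ← ih (r + 1)]
    simp only [runLaw, stateExp, Finset.sum_mul, Finset.mul_sum]
    rw [Finset.sum_comm]
    refine Finset.sum_congr rfl fun m _ => Finset.sum_congr rfl fun m' _ => ?_
    rw [prepend, mul_assoc]

theorem AlgD.sum_runLaw (hp : IsPMF p) (M : AlgD Ω p Bool n k) (x : ℕ → Bool) (i : ℕ)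
    (ν : M.S → ℝ) (j : ℕ) : ∑ m, M.runLaw x i ν j m = ∑ m, ν m := by
  induction j with
  | zero => rfl
  | succ j ih =>
    simp only [runLaw]
    rw [Finset.sum_comm, ← ih]
    refine Finset.sum_congr rfl fun m _ => ?_
    rw [← Finset.mul_sum, M.sum_transition hp, mul_one]

theorem AlgD.sum_passLaw (hp : IsPMF p) (M : AlgD Ω p Bool n k) (x : ℕ → Bool) (i : ℕ) :
    ∑ m, M.passLaw x i m = 1 := by
  induction i with
  | zero => exact sum_pr_eq_one hp _
  | succ i ih => rw [passLaw, M.sum_runLaw hp, ih]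

/-- The joint states of all passes, together with guesses of their initial states. -/
abbrev AlgD.Tuple (M : AlgD Ω p Bool n (k + 1)) : Type :=
  (Fin (k + 1) → M.S) × (Fin (k + 1) → M.S)

/-- The step kernel of all passes run in parallel. -/
def AlgD.tupleKernel (M : AlgD Ω p Bool n (k + 1)) (a : ℕ) : ℕ → Bool → M.Tuple → M.Tuple → ℝ :=
  tensor fun i j b => M.transition i j (if j < a then true else b)

/-- The initial weights of the passes run in parallel from guessed states. -/
def AlgD.tupleStart (M : AlgD Ω p Bool n (k + 1)) (z : M.Tuple) : ℝ :=
  if z.2 = z.1 then pr p fun ω => M.init ω = z.1 0 else 0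

/-- The indicator that all guesses are confirmed. -/
def AlgD.tupleAcc (M : AlgD Ω p Bool n (k + 1)) (z : M.Tuple) : ℝ :=
  ∏ i : Fin k, if z.2 i.castSucc = z.1 i.succ then 1 else 0

theorem AlgD.sum_tupleStart_mul (M : AlgD Ω p Bool n (k + 1)) (a : ℕ) (x : ℕ → Bool)
    (H : M.S → ℝ) :
    ∑ z, M.tupleStart z * stateExp (M.tupleKernel a) x 0 n
        (fun z' => H (z'.2 (Fin.last k)) * M.tupleAcc z') z =
      ∑ m, M.passLaw (prepend a x) (k + 1) m * H m := by
  rw [← sum_chain k (fun i m m' => stateExp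
    (fun j b => M.transition i j (if j < a then true else b)) x 0 n
      (fun s => if s = m' then 1 else 0) m) (M.passLaw (prepend a x))]
  · rw [Fintype.sum_prod_type]
    refine Finset.sum_congr rfl fun g _ => ?_
    rw [Finset.sum_eq_single g]
    · rw [tupleKernel, stateExp_tensor, Finset.mul_sum]
      simp only [tupleStart, tupleAcc, if_true]
      rfl
    · intro m _ hm
      simp [tupleStart, hm]
    · simp
  · intro i m'
    have := M.sum_runLaw_mul a x i (M.passLaw (prepend a x) i) n 0 fun s => if s = m' then 1 else 0
    simpa [stateExp, passLaw] using this

/-- All passes run in parallel, from guessed states. -/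
def AlgD.program (M : AlgD Ω p Bool n (k + 1)) (hp : IsPMF p) (a : ℕ) : Program M.Tuple where
  q := M.tupleKernel a
  kernel := isKernel_tensor fun i =>
    ⟨fun _ _ _ _ => M.transition_nonneg hp _ _ _ _ _, fun _ _ _ => M.sum_transition hp _ _ _ _⟩
  start := M.tupleStart
  start_nonneg z := by
    unfold tupleStart
    split_ifs
    · exact Finset.sum_nonneg fun ω _ => by split_ifs <;> simp [hp.nonneg ω]
    · exact le_rfl
  acc := M.tupleAcc
  acc_nonneg z := Finset.prod_nonneg fun i _ => by split_ifs <;> simp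
  acc_le_one z := Finset.prod_le_one (fun i _ => by split_ifs <;> simp)
    fun i _ => by split_ifs <;> simp
  len := n
  total x := by
    have := M.sum_tupleStart_mul a x fun _ => 1
    simp only [one_mul, mul_one] at this
    rw [this, M.sum_passLaw hp]

theorem AlgD.sum_tupleStart (hp : IsPMF p) (M : AlgD Ω p Bool n (k + 1)) :
    ∑ z, M.tupleStart z = (Fintype.card M.S : ℝ) ^ k := by
  rw [Fintype.sum_prod_type]
  simp only [tupleStart]
  simp only [Finset.sum_ite_eq', Finset.mem_univ, if_true]
  rw [sum_fin_cons]
  simp only [Fin.cons_zero, Finset.sum_const, Finset.card_univ, Fintype.card_fun, Fintype.card_fin,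
    nsmul_eq_mul]
  rw [← Finset.mul_sum, sum_pr_eq_one hp]
  simp

theorem AlgD.loss_program_le {RO : Type} [Fintype RO] (hp : IsPMF p)
    (M : AlgD Ω p Bool n (k + 1)) {rout : Ω → RO}
    (hout : ∀ (m : M.S) (r : ℕ → ℕ → M.Rv) (u : RO),
      pr p (fun ω => M.init ω = m ∧ (∀ i < k + 1, ∀ j < n, M.R i j ω = r i j) ∧ rout ω = u) =
        pr p (fun ω => M.init ω = m ∧ ∀ i < k + 1, ∀ j < n, M.R i j ω = r i j) *
          pr p fun ω => rout ω = u)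
    {a : ℕ} (ha : a ≤ n) (h : M.S → RO → ℝ) :
    (M.program hp a).loss a n ≤ coinExp 0 n (fun x => ∑ ω, p ω *
      (seg a n x - h (M.final (prepend a x) ω) (rout ω)) ^ 2) fun _ => true := by
  have h1 : ∀ u, (M.program hp a).loss a n ≤ coinExp 0 n (fun x =>
      ∑ m, M.passLaw (prepend a x) (k + 1) m * (seg a n x - h m u) ^ 2) fun _ => true := by
    intro u
    refine ((M.program hp a).loss_le_expect ha fun z => h (z.2 (Fin.last k)) u).trans ?_
    rw [(M.program hp a).expect_state fun x z =>
      (seg a (M.program hp a).len x - h (z.2 (Fin.last k)) u) ^ 2]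
    refine le_of_eq ?_
    congr 1
    funext x
    exact M.sum_tupleStart_mul a x fun m => (seg a n x - h m u) ^ 2
  calc _ = ∑ u, pr p (fun ω => rout ω = u) * (M.program hp a).loss a n := by
        rw [← Finset.sum_mul, sum_pr_eq_one hp, one_mul]
    _ ≤ ∑ u, pr p (fun ω => rout ω = u) * coinExp 0 n (fun x =>
          ∑ m, M.passLaw (prepend a x) (k + 1) m * (seg a n x - h m u) ^ 2) fun _ => true := by
        refine Finset.sum_le_sum fun u _ => mul_le_mul_of_nonneg_left (h1 u) ?_
        exact Finset.sum_nonneg fun ω _ => by split_ifs <;> simp [hp.nonneg ω]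
    _ = _ := by
        simp only [← coinExp_mul_left, ← coinExp_sum]
        congr 1
        funext x
        exact (M.sum_final hout (prepend a x) fun m u => (seg a n x - h m u) ^ 2).symm

end Program

section Counter

theorem sum_coin_prepend_of_le {a m : ℕ} (h : m ≤ a) (x : ℕ → Bool) :
    ∑ j ∈ Finset.range m, coin (prepend a x j) = m := by
  rw [Finset.sum_congr rfl fun j hj => ?_, Finset.sum_const, Finset.card_range, nsmul_eq_mul,
    mul_one]
  rw [Finset.mem_range] at hj
  simp [prepend, coin, (by omega : j < a)]

theorem sum_coin_prepend {a m : ℕ} (h : a ≤ m) (x : ℕ → Bool) :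
    ∑ j ∈ Finset.range m, coin (prepend a x j) = a + seg a m x := by
  rw [← Finset.sum_range_add_sum_Ico _ h, sum_coin_prepend_of_le le_rfl, seg]
  congr 1
  refine Finset.sum_congr rfl fun j hj => ?_
  rw [Finset.mem_Ico] at hj
  rw [prepend, if_neg (by omega)]

/-- The increment after time `a` estimated from the estimate `c` of a counter that is `a` at
time `a`. -/
def increment (a c : ℝ) : ℝ := max 0 (min c (2 * a)) - a

theorem abs_increment_le {a : ℝ} (ha : 0 ≤ a) (c : ℝ) : |increment a c| ≤ a := by
  rw [increment, abs_le]
  constructor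
  · linarith [le_max_left 0 (min c (2 * a))]
  · linarith [max_le (by linarith : 0 ≤ 2 * a) (min_le_right c (2 * a))]

theorem abs_sub_increment_le {a S : ℝ} (hS : |S| ≤ a) (c : ℝ) :
    |S - increment a c| ≤ |c - (a + S)| := by
  rw [abs_le] at hS
  have h : (a + S) = max 0 (min (a + S) (2 * a)) := by
    rw [min_eq_left (by linarith), max_eq_right (by linarith)]
  calc |S - increment a c| = |max 0 (min (a + S) (2 * a)) - max 0 (min c (2 * a))| := by
        rw [← h, increment]; ring_nf
    _ ≤ |min (a + S) (2 * a) - min c (2 * a)| := by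
        have := abs_max_sub_max_le_abs (min (a + S) (2 * a)) (min c (2 * a)) 0
        rwa [max_comm _ 0, max_comm _ 0] at this
    _ ≤ |(a + S) - c| := by
        have := abs_min_sub_min_le_max (a + S) (2 * a) c (2 * a)
        simpa using this
    _ = _ := abs_sub_comm _ _

theorem sq_sub_increment_le {a S ε : ℝ} (ha : 0 < a) (hε : 0 ≤ ε) (c : ℝ) :
    (S - increment a c) ^ 2 ≤ 4 * S ^ 4 / a ^ 2 + 4 * ε ^ 2 * a ^ 2 + 4 * a ^ 2 *
      if (1 - ε) * (a + S) ≤ c ∧ c ≤ (1 + ε) * (a + S) then 0 else 1 := by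
  have hi := abs_le.1 (abs_increment_le ha.le c)
  have h1 : 0 ≤ 4 * S ^ 4 / a ^ 2 := by positivity
  have h2 : 0 ≤ 4 * ε ^ 2 * a ^ 2 := by positivity
  have h3 : 0 ≤ 4 * a ^ 2 *
      (if (1 - ε) * (a + S) ≤ c ∧ c ≤ (1 + ε) * (a + S) then 0 else 1 : ℝ) := by
    split_ifs <;> positivity
  rcases le_or_gt |S| a with hS | hS
  · split_ifs at h3 ⊢ with hg
    · have h4 := abs_sub_increment_le hS c
      rw [abs_le] at hS
      have h5 : |c - (a + S)| ≤ 2 * ε * a := by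
        rw [abs_le]; constructor <;> nlinarith
      have h6 := sq_le_sq'
        (by linarith [abs_nonneg (S - increment a c), neg_abs_le (S - increment a c)])
        ((le_abs_self (S - increment a c)).trans (h4.trans h5))
      nlinarith
    · rw [abs_le] at hS
      have : (S - increment a c) ^ 2 ≤ (2 * a) ^ 2 := sq_le_sq' (by linarith) (by linarith)
      nlinarith
  · have h4 : |S - increment a c| ≤ 2 * |S| := by
      have := abs_sub S (increment a c)
      linarith [abs_increment_le ha.le c]
    have h5 : (S - increment a c) ^ 2 ≤ 4 * S ^ 2 := by
      rw [← sq_abs, ← sq_abs S]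
      nlinarith [abs_nonneg (S - increment a c)]
    have h6 : 4 * S ^ 2 ≤ 4 * S ^ 4 / a ^ 2 := by
      rw [le_div_iff₀ (by positivity)]
      have : a ^ 2 ≤ S ^ 2 := by rw [← sq_abs S]; gcongr
      nlinarith [sq_nonneg S]
    linarith

variable {Ω : Type} [Fintype Ω] {p : Ω → ℝ}

theorem pr_not (hp : IsPMF p) (E : Ω → Prop) : pr p (fun ω => ¬ E ω) = 1 - pr p E := by
  rw [eq_sub_iff_add_eq, ← hp.sum_one, pr, pr, ← Finset.sum_add_distrib]
  exact Finset.sum_congr rfl fun ω _ => by by_cases h : E ω <;> simp [h]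

theorem pr_nonneg (hp : IsPMF p) (E : Ω → Prop) : 0 ≤ pr p E :=
  Finset.sum_nonneg fun ω _ => by split_ifs <;> simp [hp.nonneg ω]

/-- The expected squared error of the increment on a fixed input. -/
theorem sum_sq_sub_increment_le (hp : IsPMF p) {a n : ℕ} (ha : 0 < a) (han : a ≤ n) {ε γ : ℝ}
    (hε : 0 ≤ ε) (hγ : 0 ≤ γ) {out : (ℕ → Bool) → Ω → ℝ}
    (hacc : ∀ x : ℕ → Bool, (∀ m ≤ n, (0 : ℝ) ≤ ∑ j ∈ Finset.range m, coin (x j)) →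
      1 - γ ≤ pr p (fun ω => (1 - ε) * (∑ j ∈ Finset.range n, coin (x j)) ≤ out x ω ∧
        out x ω ≤ (1 + ε) * (∑ j ∈ Finset.range n, coin (x j)))) (x : ℕ → Bool) :
    ∑ ω, p ω * (seg a n x - increment a (out (prepend a x) ω)) ^ 2 ≤
      4 / (a : ℝ) ^ 2 * seg a n x ^ 4 + (4 * ε ^ 2 * a ^ 2 + 4 * a ^ 2 * γ + 4 * a ^ 2 *
        if ∃ m, a ≤ m ∧ m ≤ a + (n - a) ∧ a + seg a m x < 0 then 1 else 0) := by
  set bad : ℝ := pr p fun ω => ¬ ((1 - ε) * (a + seg a n x) ≤ out (prepend a x) ω ∧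
    out (prepend a x) ω ≤ (1 + ε) * (a + seg a n x)) with hbad
  have h1 : ∑ ω, p ω * (seg a n x - increment a (out (prepend a x) ω)) ^ 2 ≤
      4 * seg a n x ^ 4 / (a : ℝ) ^ 2 + 4 * ε ^ 2 * a ^ 2 + 4 * a ^ 2 * bad := by
    have e : 4 * seg a n x ^ 4 / (a : ℝ) ^ 2 + 4 * ε ^ 2 * a ^ 2 + 4 * a ^ 2 * bad =
        ∑ ω, p ω * (4 * seg a n x ^ 4 / (a : ℝ) ^ 2 + 4 * ε ^ 2 * a ^ 2 + 4 * a ^ 2 *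
          if (1 - ε) * (a + seg a n x) ≤ out (prepend a x) ω ∧
            out (prepend a x) ω ≤ (1 + ε) * (a + seg a n x) then 0 else 1) := by
      simp only [mul_add (p _), Finset.sum_add_distrib, ← Finset.sum_mul, hp.sum_one, one_mul,
        hbad, pr, Finset.mul_sum]
      congr 1
      refine Finset.sum_congr rfl fun ω _ => ?_
      split_ifs <;> ring
    rw [e]
    exact Finset.sum_le_sum fun ω _ => mul_le_mul_of_nonneg_left
      (sq_sub_increment_le (by exact_mod_cast ha) hε _) (hp.nonneg ω)
  have h2 : bad ≤ γ + if ∃ m, a ≤ m ∧ m ≤ a + (n - a) ∧ a + seg a m x < 0 then 1 else 0 := by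
    split_ifs with hd
    · rw [hbad, pr_not hp]
      have := pr_nonneg hp fun ω => (1 - ε) * (a + seg a n x) ≤ out (prepend a x) ω ∧
        out (prepend a x) ω ≤ (1 + ε) * (a + seg a n x)
      linarith
    · rw [hbad, pr_not hp]
      have := hacc (prepend a x) fun m hm => ?_
      · rw [sum_coin_prepend han] at this
        linarith
      · rcases le_total m a with h | h
        · rw [sum_coin_prepend_of_le h]; positivity
        · rw [sum_coin_prepend h]
          by_contra hneg
          exact hd ⟨m, h, by omega, not_le.1 hneg⟩
  have h3 : 4 * (a : ℝ) ^ 2 * bad ≤ 4 * a ^ 2 * (γ +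
      if ∃ m, a ≤ m ∧ m ≤ a + (n - a) ∧ a + seg a m x < 0 then 1 else 0) := by gcongr
  calc _ ≤ _ := h1
    _ ≤ _ := by
      rw [mul_add] at h3
      have : 4 * seg a n x ^ 4 / (a : ℝ) ^ 2 = 4 / (a : ℝ) ^ 2 * seg a n x ^ 4 := by ring
      linarith

theorem coinExp_increment_le {a n : ℕ} (han : a ≤ n) {lam ε γ : ℝ} (hlam : 0 ≤ lam) :
    coinExp 0 n (fun x => 4 / (a : ℝ) ^ 2 * seg a n x ^ 4 + (4 * ε ^ 2 * a ^ 2 + 4 * a ^ 2 * γ +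
      4 * a ^ 2 * if ∃ m, a ≤ m ∧ m ≤ a + (n - a) ∧ a + seg a m x < 0 then 1 else 0))
        (fun _ => true) ≤
      12 * ((n - a : ℕ) : ℝ) ^ 2 / a ^ 2 + 4 * ε ^ 2 * a ^ 2 + 4 * a ^ 2 * γ +
        4 * a ^ 2 * (Real.exp (-(lam * a)) * Real.cosh lam ^ (n - a)) := by
  rw [coinExp_add, coinExp_add, coinExp_mul_left, coinExp_mul_left, coinExp_const,
    coinExp_seg_mid han le_rfl (fun s => s ^ 4), walkExp_four]
  have h1 : coinExp 0 n (fun x => if ∃ m, a ≤ m ∧ m ≤ a + (n - a) ∧ a + seg a m x < 0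
      then (1 : ℝ) else 0) (fun _ => true) ≤
      Real.exp (-(lam * a)) * Real.cosh lam ^ (n - a) := by
    have := coinExp_comp 0 a (n - a) (fun x => if ∃ m, a ≤ m ∧ m ≤ a + (n - a) ∧
      a + seg a m x < 0 then (1 : ℝ) else 0) fun _ => true
    rw [show a + (n - a) = n by omega] at this ⊢
    rw [this, ← coinExp_const 0 a (Real.exp (-(lam * a)) * Real.cosh lam ^ (n - a)) fun _ => true]
    refine coinExp_mono fun x' => ?_
    have := coinExp_exists_neg_le hlam a (n - a) a x'
    rw [show a + (n - a) = n by omega] at this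
    rwa [zero_add a]
  have h2 : 4 / (a : ℝ) ^ 2 * (0 ^ 4 + 6 * ((n - a : ℕ) : ℝ) * 0 ^ 2 +
      3 * ((n - a : ℕ) : ℝ) ^ 2 - 2 * ((n - a : ℕ) : ℝ)) ≤
      12 * ((n - a : ℕ) : ℝ) ^ 2 / a ^ 2 := by
    calc _ ≤ 4 / (a : ℝ) ^ 2 * (3 * ((n - a : ℕ) : ℝ) ^ 2) := by
          gcongr
          nlinarith [Nat.cast_nonneg (α := ℝ) (n - a)]
      _ = _ := by ring
  have h3 : 4 * (a : ℝ) ^ 2 * _ ≤ 4 * a ^ 2 * _ := mul_le_mul_of_nonneg_left h1 (by positivity)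
  linarith

/-- The error bound for a window of length about `n` after a prefix of length about
`1000 * √n`. -/
theorem error_le {n q a : ℕ} (hq : 2000 ≤ q) (h1 : q * q ≤ n) (h2 : n < (q + 1) * (q + 1))
    (ha : a = 1000 * q) :
    12 * ((n - a : ℕ) : ℝ) ^ 2 / a ^ 2 + 4 * (1 / 10 ^ 5) ^ 2 * a ^ 2 + 4 * a ^ 2 * (1 / 10 ^ 10) +
      4 * a ^ 2 * (Real.exp (-(1 / q * a)) * Real.cosh (1 / q) ^ (n - a)) ≤
      ((n - a : ℕ) : ℝ) / 100 := by
  have hq0 : (0 : ℝ) < q := by exact_mod_cast (by omega : 0 < q)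
  have haN : 2 * a ≤ n := by nlinarith
  have hNq : n - a ≤ q * q := by
    have : (q + 1) * (q + 1) = q * q + 2 * q + 1 := by ring
    omega
  have hqN : q * q ≤ 2 * (n - a) := by omega
  have haq : (a : ℝ) = 1000 * q := by rw [ha]; push_cast; ring
  set N := n - a
  have hNq' : (N : ℝ) ≤ (q : ℝ) ^ 2 := by rw [sq]; exact_mod_cast hNq
  have hqN' : (q : ℝ) ^ 2 ≤ 2 * N := by rw [sq]; exact_mod_cast hqN
  have hN0 : (0 : ℝ) ≤ N := Nat.cast_nonneg N
  have e1 : 12 * (N : ℝ) ^ 2 / a ^ 2 ≤ 12 / 10 ^ 6 * N := by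
    rw [haq, div_le_iff₀ (by positivity)]
    nlinarith
  have e2 : Real.exp (-(1 / q * a)) * Real.cosh (1 / q) ^ N ≤ 1 / 10 ^ 10 := by
    have f1 : Real.cosh (1 / q) ^ N ≤ Real.exp 1 := by
      calc _ ≤ Real.exp ((1 / q) ^ 2 / 2) ^ N := by
            gcongr
            exact Real.cosh_le_exp_half_sq _
        _ = Real.exp (N * ((1 / q) ^ 2 / 2)) := (Real.exp_nat_mul _ _).symm
        _ ≤ _ := by
          apply Real.exp_le_exp.2
          have : (N : ℝ) * ((1 / q) ^ 2 / 2) = N / q ^ 2 / 2 := by ring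
          rw [this]
          have : (N : ℝ) / q ^ 2 ≤ 1 := by rw [div_le_one (by positivity)]; exact hNq'
          linarith
    have f2 : Real.exp (-(1 / q * a)) = Real.exp (-1000) := by
      rw [haq]; congr 1; field_simp
    rw [f2]
    calc _ ≤ Real.exp (-1000) * Real.exp 1 := by gcongr
      _ = (Real.exp 999)⁻¹ := by rw [← Real.exp_add, ← Real.exp_neg]; norm_num
      _ ≤ (10 ^ 10)⁻¹ := by
        have := Real.pow_div_factorial_le_exp 999 (by norm_num) 4
        refine inv_anti₀ (by norm_num) (le_trans ?_ this)
        norm_num [Nat.factorial]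
      _ = _ := by norm_num
  have e3 : (a : ℝ) ^ 2 ≤ 2 * 10 ^ 6 * N := by rw [haq]; nlinarith
  have e4 : 4 * (a : ℝ) ^ 2 * (Real.exp (-(1 / q * a)) * Real.cosh (1 / q) ^ N) ≤
      4 * a ^ 2 * (1 / 10 ^ 10) := by gcongr
  nlinarith

end Counter

theorem logb_le_twelve_mul_log {n : ℕ} (hn : 4 * 64 ^ 2 ≤ n) :
    Real.logb 2 n ≤ 12 * Nat.log 64 (n / 4) := by
  have hL : 2 ≤ Nat.log 64 (n / 4) := Nat.le_log_of_pow_le (by norm_num) (by omega)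
  have h1 : n / 4 < 64 ^ (Nat.log 64 (n / 4) + 1) := Nat.lt_pow_succ_log_self (by norm_num) _
  set L := Nat.log 64 (n / 4)
  have h2 : n ≤ 2 ^ (12 * L) := by
    calc n ≤ 4 * 64 ^ (L + 1) := by omega
      _ = 2 ^ (6 * L + 8) := by
        rw [show 64 = 2 ^ 6 by norm_num, ← pow_mul, show 4 = 2 ^ 2 by norm_num, ← pow_add]
        congr 1; ring
      _ ≤ _ := Nat.pow_le_pow_right (by norm_num) (by omega)
  rw [Real.logb_le_iff_le_rpow (by norm_num) (by exact_mod_cast (by omega : 0 < n))]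
  have : (n : ℝ) ≤ 2 ^ (12 * L) := by exact_mod_cast h2
  rw [← Real.rpow_natCast] at this
  push_cast at this
  exact this

/-- Theorem 1.3, multi-pass counter in strict turnstile streams: there
exist constants `ε, γ ∈ (0,1)`, `c > 0` and `n₀` such that for all `n ≥ n₀` and all
`k < log₂ n` the following holds.  Let `M` be a `k`-pass streaming algorithm with `s` bits
of memory on streams in `{-1,1}^n`, whose real-valued output is a (possibly randomized)
function `g` of the final memory state (using output randomness `rout` independent of the
algorithm's internal randomness).  If for every strict turnstile stream `x` (all prefix
sums nonnegative), with probability at least `1-γ` the output `C'` satisfies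
`(1-ε)·C ≤ C' ≤ (1+ε)·C` where `C = Σ_j x_j`, then `s ≥ c·(log₂ n)/k`. -/
theorem strict_turnstile_counter_lower_bound :
    ∃ ε : ℝ, 0 < ε ∧ ε < 1 ∧ ∃ γ : ℝ, 0 < γ ∧ γ < 1 ∧ ∃ c : ℝ, 0 < c ∧ ∃ n₀ : ℕ,
      ∀ n : ℕ, n₀ ≤ n → ∀ k : ℕ, 1 ≤ k → (k : ℝ) < Real.logb 2 n →
        ∀ (Ω : Type) [Fintype Ω], ∀ (p : Ω → ℝ), IsPMF p →
          ∀ (s : ℕ) (M : AlgD Ω p Bool n k), Fintype.card M.S ≤ 2 ^ s →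
            ∀ (RO : Type) [Fintype RO], ∀ (rout : Ω → RO) (g : M.S → RO → ℝ),
              -- the output randomness is independent of the internal randomness:
              (∀ (m : M.S) (r : ℕ → ℕ → M.Rv) (u : RO),
                pr p (fun ω => M.init ω = m ∧ (∀ i < k, ∀ j < n, M.R i j ω = r i j) ∧
                    rout ω = u)
                  = pr p (fun ω => M.init ω = m ∧ ∀ i < k, ∀ j < n, M.R i j ω = r i j) *
                    pr p (fun ω => rout ω = u)) →
              -- on every strict turnstile stream, the output is a `(1±ε)`-approximation of
              -- the counter with probability at least `1-γ`:
              (∀ x : ℕ → Bool,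
                (∀ m ≤ n, (0 : ℝ) ≤ ∑ j ∈ Finset.range m, coin (x j)) →
                1 - γ ≤ pr p (fun ω =>
                  (1 - ε) * (∑ j ∈ Finset.range n, coin (x j)) ≤ g (M.final x ω) (rout ω) ∧
                  g (M.final x ω) (rout ω) ≤ (1 + ε) * (∑ j ∈ Finset.range n, coin (x j)))) →
              c * Real.logb 2 n / k ≤ (s : ℝ) := by
  refine ⟨1 / 10 ^ 5, by norm_num, by norm_num, 1 / 10 ^ 10, by norm_num, by norm_num,
    1 / 1152, by norm_num, 2000 * 2000, ?_⟩
  intro n hn k hk _ Ω _ p hp s M hS RO _ rout g hout hacc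
  obtain ⟨k, rfl⟩ := Nat.exists_eq_add_of_le' hk
  have hq : 2000 ≤ Nat.sqrt n := Nat.le_sqrt.2 hn
  have hq1 : Nat.sqrt n * Nat.sqrt n ≤ n := Nat.sqrt_le n
  obtain ⟨a, ha⟩ : ∃ a, a = 1000 * Nat.sqrt n := ⟨_, rfl⟩
  have ha2 : 2 * a ≤ n := by nlinarith
  have han : a ≤ n := by omega
  have hloss : (M.program hp a).loss a n ≤ ((n - a : ℕ) : ℝ) / 100 := by
    refine (M.loss_program_le hp hout han fun m u => increment a (g m u)).trans ?_
    refine (coinExp_mono fun x => sum_sq_sub_increment_le hp (by omega) han (by norm_num)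
      (by norm_num) hacc x).trans ?_
    refine (coinExp_increment_le han (lam := 1 / Nat.sqrt n) (by positivity)).trans ?_
    exact error_le hq hq1 (Nat.lt_succ_sqrt n) ha
  set L := Nat.log 64 (n / 4) with hL
  have hL1 : 64 ^ L ≤ n / 4 := Nat.pow_log_le_self 64 (by omega)
  have hcard := (M.program hp a).exp_le_card_mul (L := L)
    (show a + 2 * 64 ^ L ≤ n by omega) hloss
  have hstart : ∑ z, (M.program hp a).start z = (Fintype.card M.S : ℝ) ^ k := M.sum_tupleStart hp
  rw [hstart, Fintype.card_prod, Fintype.card_fun, Fintype.card_fin] at hcard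
  push_cast at hcard
  have hw : (Fintype.card M.S : ℝ) ≤ 2 ^ s := by exact_mod_cast hS
  have h2 : Real.exp (L / 32) ≤ Real.exp (3 * (k + 1) * s) := by
    calc _ ≤ ((2 : ℝ) ^ s) ^ (k + 1) * (2 ^ s) ^ (k + 1) * (2 ^ s) ^ k := hcard.trans (by gcongr)
      _ ≤ ((2 : ℝ) ^ s) ^ (k + 1) * (2 ^ s) ^ (k + 1) * (2 ^ s) ^ (k + 1) := by
        gcongr
        · exact one_le_pow₀ (by norm_num)
        · omega
      _ = 2 ^ (3 * (k + 1) * s) := by ring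
      _ ≤ Real.exp 1 ^ (3 * (k + 1) * s) := by
        gcongr
        linarith [Real.add_one_le_exp (1 : ℝ)]
      _ = _ := by rw [← Real.exp_nat_mul]; push_cast; ring_nf
  have h3 := Real.exp_le_exp.1 h2
  have h4 := logb_le_twelve_mul_log (n := n) (by omega)
  rw [div_le_iff₀ (by positivity)]
  push_cast
  rw [← hL] at h4
  linarith

end MultiPassIC
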